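/- arXiv:1407.4567 — 6 statements merged into one kernel-verified Lean document; each statement's English description precedes it below -/
import Mathlib

section
/- Let K be a field of characteristic p > 2, let f, g ∈ K[X] be additive polynomials with f'(0)·g'(0) ≠ 0, and set F(X) := X·f(X) and G(X) := X·g(X). Then the bivariate polynomial F(X) − G(Y) is reducible in K[X,Y] if and only if there exists a nonzero element δ of an algebraic closure of K such that g(Y) = δ·f(δ·Y) and moreover either deg(f) > 1 or δ ∈ K. -/
open Polynomial

/-- A polynomial `f ∈ K[X]` is additive if `f(X+Y) = f(X) + f(Y)` holds as an identity
of polynomials in two variables over `K` (we work in `K[Y][X]`, where the inner variable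
plays the role of `Y` and the outer variable plays the role of `X`). -/
def IsAdditive {K : Type*} [CommSemiring K] (f : Polynomial K) : Prop :=
    Polynomial.aeval ((Polynomial.C Polynomial.X + Polynomial.X : Polynomial (Polynomial K))) f =
      Polynomial.aeval ((Polynomial.C Polynomial.X : Polynomial (Polynomial K))) f +
        Polynomial.aeval ((Polynomial.X : Polynomial (Polynomial K))) f

theorem resultant_natDegree_of_monic {R : Type*} [CommRing R] {A : R[X]} (hA : A.Monic) (g : R[X])
    {n : ℕ} (hn : g.natDegree ≤ n) : resultant A g A.natDegree n = resultant A g := by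
  obtain ⟨k, rfl⟩ := Nat.exists_eq_add_of_le hn
  rw [resultant_add_right_deg _ _ _ _ _ le_rfl, coeff_natDegree, hA.leadingCoeff, one_pow, one_mul]

theorem resultant_add_self_mul_of_monic {R : Type*} [CommRing R] {A : R[X]} (hA : A.Monic)
    (g q : R[X]) : resultant A (g + A * q) = resultant A g := by
  set n := max (q.natDegree + A.natDegree) (max g.natDegree (g + A * q).natDegree)
  rw [← resultant_natDegree_of_monic hA (g + A * q) (n := n) (by simp [n]),
    ← resultant_natDegree_of_monic hA g (n := n) (by simp [n]),
    resultant_add_mul_right _ _ _ _ _ (by simp [n]) le_rfl]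

theorem resultant_mul_of_monic {R : Type*} [CommRing R] [IsDomain R] {A : R[X]} (hA : A.Monic)
    (g h : R[X]) : resultant A (g * h) = resultant A g * resultant A h := by
  rw [← resultant_mul_right _ _ _ _ le_rfl, resultant_natDegree_of_monic hA _ natDegree_mul_le]

/-- The square of the resultant of two factors divides the discriminant. -/
theorem resultant_sq_dvd_resultant_derivative {R : Type*} [CommRing R] [IsDomain R] {A B : R[X]}
    (hA : A.Monic) (hB : B.Monic) :
    resultant A B ^ 2 ∣ resultant (A * B) (derivative (A * B)) := by
  have h : resultant (A * B) (derivative (A * B)) =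
      resultant A (derivative (A * B)) * resultant B (derivative (A * B)) := by
    rw [← resultant_mul_left _ _ _ _ le_rfl, hA.natDegree_mul hB]
  rw [h, sq]
  refine mul_dvd_mul ?_ ?_
  · rw [derivative_mul, resultant_add_self_mul_of_monic hA, resultant_mul_of_monic hA]
    exact dvd_mul_left _ _
  · rw [derivative_mul, add_comm, mul_comm (derivative A), resultant_add_self_mul_of_monic hB,
      resultant_mul_of_monic hB, resultant_comm A B]
    exact ((IsUnit.pow _ isUnit_one.neg).mul_left_dvd.2 dvd_rfl).trans (dvd_mul_right _ _)

theorem resultant_sq_dvd_prod_critical_values {K : Type*} [Field K] {F G : K[X]}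
    (hF : (derivative F).Splits) (hF0 : derivative F ≠ 0) {A B : K[X][X]} (hA : A.Monic)
    (hB : B.Monic) (hAB : A * B = F.map C - C G) :
    resultant A B ^ 2 ∣ ((derivative F).roots.map fun v ↦ C (F.eval v) - G).prod := by
  have h := resultant_sq_dvd_resultant_derivative hA hB
  have hd : derivative (A * B) = (derivative F).map C := by
    simp [hAB, derivative_map]
  rw [hd, resultant_comm (A * B), resultant_eq_prod_eval _ _ _ le_rfl (hF.map C), hF.roots_map,
    Multiset.map_map, hAB] at h
  have hu : IsUnit ((-1 : K[X]) ^ ((F.map C - C G).natDegree * ((derivative F).map C).natDegree) *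
      ((derivative F).map C).leadingCoeff ^ (F.map C - C G).natDegree) := by
    refine (IsUnit.pow _ isUnit_one.neg).mul (IsUnit.pow _ ?_)
    rw [leadingCoeff_map_of_injective C_injective]
    exact isUnit_C.2 (leadingCoeff_ne_zero.2 hF0).isUnit
  rw [← mul_assoc, hu.dvd_mul_left] at h
  convert h using 4 with v
  simp [eval_map]

/-- A zero of the resultant of two factors of `F(X) - G(Y)` lies below a singular point. -/
theorem exists_singular_of_resultant_eval_eq_zero {K : Type*} [Field K] [IsAlgClosed K]
    {F G : K[X]} {A B : K[X][X]} (hA : A.Monic) (hB : B.Monic) (hAB : A * B = F.map C - C G)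
    {y : K} (hy : (resultant A B).eval y = 0) :
    (derivative G).eval y = 0 ∧ ∃ x, (derivative F).eval x = 0 ∧ F.eval x = G.eval y := by
  have h0 : resultant (A.map (evalRingHom y)) (B.map (evalRingHom y)) = 0 := by
    rw [hA.natDegree_map, hB.natDegree_map, resultant_map_map, coe_evalRingHom, hy]
  have hnc := (resultant_eq_zero_iff.1 h0).2
  obtain ⟨x, hxA, hxB⟩ : ∃ x, A.evalEval y x = 0 ∧ B.evalEval y x = 0 := by
    simpa [isCoprime_iff_aeval_ne_zero_of_isAlgClosed K K, map_evalRingHom_eval] using hnc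
  have hmX := congrArg (fun P : K[X][X] ↦ (derivative P).evalEval y x) hAB
  have hm := congrArg (fun P : K[X][X] ↦ P.evalEval y x) hAB
  have hmY := congrArg (fun P : K[X][X] ↦ (derivative (P.eval (C x))).eval y) hAB
  have hFx : (F.map C).eval (C x) = C (F.eval x) := by rw [eval_map, eval₂_at_apply]
  simp only [derivative_mul, eval_mul, eval_add, evalEval_mul, evalEval_add, evalEval_sub,
    evalEval_C, hxA, hxB, mul_zero, zero_mul, add_zero, eval_sub,
    hFx, eval_C, derivative_sub, derivative_C, zero_sub, eval_neg, derivative_map,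
    evalEval_map_C, sub_zero] at hmX hm hmY
  refine ⟨by simpa using hmY.symm, x, hmX.symm, (sub_eq_zero.1 hm.symm)⟩

theorem eval₂_inv_mul_pow_natDegree {R S : Type*} [CommRing R] [Field S] (i : R →+* S) {x : S}
    (hx : x ≠ 0) (f : R[X]) : eval₂ i x⁻¹ f * x ^ f.natDegree = eval₂ i x f.reverse := by
  let _ : Invertible x⁻¹ := invertibleOfNonzero (inv_ne_zero hx)
  rw [← eval₂_reverse_mul_pow i x⁻¹ f, mul_assoc, ← mul_pow, inv_mul_cancel₀ hx, one_pow, mul_one,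
    invOf_eq_inv, inv_inv]

/-- A weighted form of Bézout's bound for two factors of `F(X) - G(Y)`, with no intersection
points at infinity. -/
theorem natDegree_mul_le_natDegree_resultant {K : Type*} [Field K] {F G : K[X]} (hF : F.Monic)
    (hN : (F.natDegree : K) ≠ 0) (hM : 0 < G.natDegree) {A B : K[X][X]} (hA : A.Monic)
    (hB : B.Monic) (hAB : A * B = F.map C - C G) :
    G.natDegree * (A.natDegree * B.natDegree) ≤ F.natDegree * (resultant A B).natDegree := by
  have hN0 : F.natDegree ≠ 0 := fun h ↦ hN (by simp [h])
  let ι := algebraMap K[X] (FractionRing K[X])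
  have hι : Function.Injective ι := IsFractionRing.injective _ _
  have hX : ι X ≠ 0 := (map_ne_zero_iff ι hι).2 X_ne_zero
  set N := F.natDegree with hNdef
  set M := G.natDegree with hMdef
  let φ : K[X] →+* FractionRing K[X] := eval₂RingHom (ι.comp C) (ι X ^ N)⁻¹
  have hφ (q : K[X]) : φ q * (ι X ^ N) ^ q.natDegree = ι (q.reverse.comp (X ^ N)) := by
    rw [coe_eval₂RingHom, eval₂_inv_mul_pow_natDegree _ (pow_ne_zero _ hX), comp, hom_eval₂, map_pow]
  let Q : K[X][X] := (F.map C).scaleRoots (X ^ M) - C (G.reverse.comp (X ^ N))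
  have hdeg : (A * B).natDegree = N := by
    rw [hAB, natDegree_sub_C, natDegree_map_eq_of_injective C_injective]
  have hQ : (A.map φ).scaleRoots (ι X ^ M) * (B.map φ).scaleRoots (ι X ^ M) = Q.map ι := by
    rw [← mul_scaleRoots_of_noZeroDivisors, ← Polynomial.map_mul]
    ext i
    rw [coeff_scaleRoots, (hA.mul hB).natDegree_map, hdeg, hAB]
    simp only [Q, Polynomial.map_sub, coeff_sub, coeff_map, coeff_scaleRoots, coeff_C,
      (hF.natDegree_map C), ← hNdef, map_C]
    rw [sub_mul, map_mul, map_pow, map_pow]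
    congr 1
    · simp [φ]
    · split_ifs with h
      · rw [h, ← hφ, ← hMdef]; simp only [Nat.sub_zero, ← pow_mul, mul_comm]
      · simp
  have hQm : Q.Monic := by
    refine monic_of_injective hι ?_
    rw [← hQ]
    exact ((monic_scaleRoots_iff _).2 (hA.map φ)).mul ((monic_scaleRoots_iff _).2 (hB.map φ))
  obtain ⟨A', hA'⟩ := IsIntegrallyClosed.eq_map_mul_C_of_dvd (FractionRing K[X]) hQm
    (Dvd.intro _ hQ)
  obtain ⟨B', hB'⟩ := IsIntegrallyClosed.eq_map_mul_C_of_dvd (FractionRing K[X]) hQm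
    (Dvd.intro_left _ hQ)
  rw [((monic_scaleRoots_iff _).2 (hA.map φ)).leadingCoeff, C_1, mul_one] at hA'
  rw [((monic_scaleRoots_iff _).2 (hB.map φ)).leadingCoeff, C_1, mul_one] at hB'
  have hA'm : A'.Monic := monic_of_injective hι (hA' ▸ (monic_scaleRoots_iff _).2 (hA.map φ))
  have hB'm : B'.Monic := monic_of_injective hι (hB' ▸ (monic_scaleRoots_iff _).2 (hB.map φ))
  have hAB' : A' * B' = Q := by
    apply map_injective ι hι
    rw [Polynomial.map_mul, ← hQ, ← hA', ← hB']
  have hQ0 : Q.map (evalRingHom 0) = X ^ N - C G.leadingCoeff := by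
    ext i
    simp only [Q, Polynomial.map_sub, coeff_sub, coeff_map, coeff_scaleRoots, coeff_C,
      (hF.natDegree_map C), ← hNdef, map_C, coeff_X_pow, coe_evalRingHom, eval_mul, eval_pow,
      eval_C, eval_X, eval_comp]
    congr 1
    · rcases lt_trichotomy i N with h | h | h
      · rw [if_neg h.ne, ← pow_mul, zero_pow (Nat.mul_ne_zero hM.ne' (by omega)), mul_zero]
      · simp [h, hNdef, hF.coeff_natDegree]
      · rw [if_neg h.ne', coeff_eq_zero_of_natDegree_lt h, zero_mul]
    · simp [hN0, ← coeff_zero_eq_eval_zero]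
  have hres : (resultant A' B').eval 0 ≠ 0 := by
    rw [← coe_evalRingHom, ← resultant_map_map, ← hA'm.natDegree_map (evalRingHom 0),
      ← hB'm.natDegree_map (evalRingHom 0)]
    refine resultant_ne_zero _ _ (Separable.isCoprime ?_)
    rw [← Polynomial.map_mul, hAB', hQ0]
    exact separable_X_pow_sub_C _ hN (leadingCoeff_ne_zero.2 (ne_zero_of_natDegree_gt hM))
  have key : resultant A' B' * X ^ (N * (resultant A B).natDegree) =
      X ^ (M * (A.natDegree * B.natDegree)) * (resultant A B).reverse.comp (X ^ N) := by
    apply hι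
    rw [map_mul, map_mul, ← hφ, ← resultant_map_map, ← hA'm.natDegree_map ι,
      ← hB'm.natDegree_map ι]
    erw [hA', hB']
    rw [resultant_scaleRoots, hA.natDegree_map, hB.natDegree_map, resultant_map_map, map_pow,
      map_pow, ← pow_mul, ← pow_mul, mul_assoc]
  have h1 := prime_X.pow_dvd_of_dvd_mul_left (M * (A.natDegree * B.natDegree))
    (mt X_dvd_iff.1 (by rwa [coeff_zero_eq_eval_zero])) (Dvd.intro _ key.symm)
  exact (pow_dvd_pow_iff X_ne_zero not_isUnit_X).1 h1

section EvalAdditive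

variable {L : Type*} [Field L] {f g : L[X]}

theorem derivative_eq_C_of_eval_add [Infinite L]
    (hf : ∀ x y, f.eval (x + y) = f.eval x + f.eval y) :
    derivative f = C ((derivative f).eval 0) := by
  refine Polynomial.funext fun y ↦ ?_
  have h : f.comp (X + C y) = f + C (f.eval y) :=
    Polynomial.funext fun x ↦ by simp [hf]
  simpa [derivative_comp] using congrArg (fun q ↦ (derivative q).eval 0) h

theorem derivative_X_mul_of_eval_add [Infinite L]
    (hf : ∀ x y, f.eval (x + y) = f.eval x + f.eval y) :
    derivative (X * f) = f + C ((derivative f).eval 0) * X := by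
  rw [derivative_mul, derivative_X, one_mul, mul_comm X, ← derivative_eq_C_of_eval_add hf]

theorem derivative_derivative_X_mul_of_eval_add [Infinite L]
    (hf : ∀ x y, f.eval (x + y) = f.eval x + f.eval y) :
    derivative (derivative (X * f)) = C (2 * (derivative f).eval 0) := by
  rw [derivative_X_mul_of_eval_add hf, derivative_add, derivative_C_mul, derivative_X, mul_one,
    two_mul, C_add, ← derivative_eq_C_of_eval_add hf]

theorem eval_zero_of_eval_add (hf : ∀ x y, f.eval (x + y) = f.eval x + f.eval y) :
    f.eval 0 = 0 := by
  simpa using hf 0 0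

theorem eq_C_mul_X_of_eval_add [Infinite L] (hf : ∀ x y, f.eval (x + y) = f.eval x + f.eval y)
    (hd : f.natDegree ≤ 1) : f = C ((derivative f).eval 0) * X := by
  have h0 : f.coeff 0 = 0 := by rw [coeff_zero_eq_eval_zero, eval_zero_of_eval_add hf]
  have h1 := eq_X_add_C_of_natDegree_le_one hd
  rw [h0, C_0, add_zero] at h1
  rw [h1]
  simp

theorem natDegree_pos_of_eval_derivative_ne_zero (ha : (derivative f).eval 0 ≠ 0) :
    0 < f.natDegree := by
  refine Nat.pos_of_ne_zero fun h ↦ ha ?_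
  rw [derivative_of_natDegree_zero h, eval_zero]

theorem natDegree_derivative_X_mul_of_eval_add [Infinite L] (h2 : (2 : L) ≠ 0)
    (hf : ∀ x y, f.eval (x + y) = f.eval x + f.eval y) (ha : (derivative f).eval 0 ≠ 0) :
    (derivative (X * f)).natDegree = f.natDegree := by
  rw [derivative_X_mul_of_eval_add hf]
  obtain h | h := le_or_gt f.natDegree 1
  · have hfx := eq_C_mul_X_of_eval_add hf h
    set a := (derivative f).eval 0
    rw [hfx, ← add_mul, ← C_add, ← two_mul, natDegree_C_mul_X _ ha,
      natDegree_C_mul_X _ (mul_ne_zero h2 ha)]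
  · exact natDegree_add_eq_left_of_natDegree_lt ((natDegree_C_mul_X _ ha).trans_lt h)

/-- The critical points of `X * f`, for an additive polynomial `f`. -/
noncomputable def criticalSubgroup (f : L[X])
    (hf : ∀ x y, f.eval (x + y) = f.eval x + f.eval y) : AddSubgroup L :=
  (AddMonoidHom.mk' (fun x ↦ f.eval x + (derivative f).eval 0 * x)
    fun x y ↦ by rw [hf]; ring).ker

theorem mem_criticalSubgroup [Infinite L] {hf : ∀ x y, f.eval (x + y) = f.eval x + f.eval y}
    {x : L} : x ∈ criticalSubgroup f hf ↔ (derivative (X * f)).eval x = 0 := by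
  rw [derivative_X_mul_of_eval_add hf]
  simp [criticalSubgroup, AddMonoidHom.mem_ker]

theorem eval_X_mul_of_mem_criticalSubgroup
    {hf : ∀ x y, f.eval (x + y) = f.eval x + f.eval y} {x : L}
    (hx : x ∈ criticalSubgroup f hf) :
    (X * f).eval x = -((derivative f).eval 0 * x ^ 2) := by
  have h : f.eval x + (derivative f).eval 0 * x = 0 := hx
  rw [eval_mul, eval_X, eq_neg_of_add_eq_zero_left h]
  ring

theorem derivative_X_mul_ne_zero [Infinite L] (h2 : (2 : L) ≠ 0)
    (hf : ∀ x y, f.eval (x + y) = f.eval x + f.eval y) (ha : (derivative f).eval 0 ≠ 0) :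
    derivative (X * f) ≠ 0 := by
  intro h
  have := derivative_derivative_X_mul_of_eval_add hf
  rw [h, derivative_zero, eq_comm, C_eq_zero] at this
  exact mul_ne_zero h2 ha this

theorem separable_derivative_X_mul [Infinite L] (h2 : (2 : L) ≠ 0)
    (hf : ∀ x y, f.eval (x + y) = f.eval x + f.eval y) (ha : (derivative f).eval 0 ≠ 0) :
    (derivative (X * f)).Separable := by
  rw [Separable, derivative_derivative_X_mul_of_eval_add hf]
  exact ⟨0, C (2 * (derivative f).eval 0)⁻¹, by
    rw [zero_mul, zero_add, ← C_mul, inv_mul_cancel₀ (mul_ne_zero h2 ha), C_1]⟩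

theorem finite_criticalSubgroup [Infinite L] (h2 : (2 : L) ≠ 0)
    (hf : ∀ x y, f.eval (x + y) = f.eval x + f.eval y) (ha : (derivative f).eval 0 ≠ 0) :
    Finite (criticalSubgroup f hf) := by
  classical
  refine Set.Finite.subset (s := (derivative (X * f)).roots.toFinset) (Finset.finite_toSet _)
    fun x hx ↦ ?_
  rw [Finset.mem_coe, Multiset.mem_toFinset, mem_roots (derivative_X_mul_ne_zero h2 hf ha)]
  exact mem_criticalSubgroup.1 hx

theorem card_criticalSubgroup [IsAlgClosed L] (h2 : (2 : L) ≠ 0)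
    (hf : ∀ x y, f.eval (x + y) = f.eval x + f.eval y) (ha : (derivative f).eval 0 ≠ 0) :
    Nat.card (criticalSubgroup f hf) = f.natDegree := by
  have : Infinite L := IsAlgClosed.instInfinite
  rw [← natDegree_derivative_X_mul_of_eval_add h2 hf ha,
    ← card_rootSet_eq_natDegree (K := L) (separable_derivative_X_mul h2 hf ha)
      (IsAlgClosed.splits _), ← Nat.card_eq_fintype_card]
  refine Nat.card_congr (Equiv.setCongr (Set.ext fun x ↦ ?_))
  rw [mem_rootSet, SetLike.mem_coe, mem_criticalSubgroup, coe_aeval_eq_eval]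
  exact (and_iff_right (derivative_X_mul_ne_zero h2 hf ha)).symm

theorem odd_card_criticalSubgroup [Infinite L] (h2 : (2 : L) ≠ 0)
    (hf : ∀ x y, f.eval (x + y) = f.eval x + f.eval y) (ha : (derivative f).eval 0 ≠ 0) :
    Odd (Nat.card (criticalSubgroup f hf)) := by
  have := finite_criticalSubgroup h2 hf ha
  rw [← Nat.not_even_iff_odd, even_iff_two_dvd]
  intro h
  obtain ⟨x, hx⟩ := exists_prime_addOrderOf_dvd_card' 2 h
  have h1 : (2 : L) * x = 0 := by
    have := congrArg (Subtype.val) (addOrderOf_nsmul_eq_zero x)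
    rw [hx] at this
    simpa [two_mul, two_nsmul] using this
  have hx0 : x = 0 := Subtype.ext ((mul_eq_zero.1 h1).resolve_left h2)
  rw [hx0, addOrderOf_zero] at hx
  omega

theorem rootMultiplicity_C_sub_X_mul_le_two [Infinite L] (h2 : (2 : L) ≠ 0)
    (hg : ∀ x y, g.eval (x + y) = g.eval x + g.eval y) (hb : (derivative g).eval 0 ≠ 0)
    (c y : L) : (C c - X * g).rootMultiplicity y ≤ 2 := by
  by_contra! h
  have := isRoot_iterate_derivative_of_lt_rootMultiplicity h
  simp only [Function.iterate_succ, Function.iterate_zero, Function.comp_apply, id_eq,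
    derivative_sub, derivative_C, zero_sub, derivative_neg,
    derivative_derivative_X_mul_of_eval_add hg, IsRoot.def, eval_neg, eval_C, neg_eq_zero] at this
  exact mul_ne_zero h2 hb this

end EvalAdditive

/-- Each nonzero common critical point lies below at most two nodes of `X f(X) = Y g(Y)`, and
the origin is a single node. -/
theorem natDegree_resultant_lt {L : Type*} [Field L] [IsAlgClosed L] (h2 : (2 : L) ≠ 0)
    {f g : L[X]} (hf : ∀ x y, f.eval (x + y) = f.eval x + f.eval y)
    (hg : ∀ x y, g.eval (x + y) = g.eval x + g.eval y) (ha : (derivative f).eval 0 ≠ 0)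
    (hb : (derivative g).eval 0 ≠ 0) {δ : L}
    (hδ : (derivative g).eval 0 = δ ^ 2 * (derivative f).eval 0)
    {A B : L[X][X]} (hA : A.Monic) (hB : B.Monic) (hAB : A * B = (X * f).map C - C (X * g)) :
    (resultant A B).natDegree <
      2 * Nat.card ↥(criticalSubgroup g hg ⊓
        (criticalSubgroup f hf).comap (AddMonoidHom.mulLeft δ)) := by
  classical
  have : Infinite L := IsAlgClosed.instInfinite
  have hcrit {x y : L} (hx : x ∈ criticalSubgroup f hf) (hy : y ∈ criticalSubgroup g hg)
      (hxy : (X * f).eval x = (X * g).eval y) : x = δ * y ∨ x = -(δ * y) := by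
    rw [eval_X_mul_of_mem_criticalSubgroup hx, eval_X_mul_of_mem_criticalSubgroup hy, hδ] at hxy
    refine sq_eq_sq_iff_eq_or_eq_neg.1 (mul_left_cancel₀ ha ?_)
    linear_combination -hxy
  set R := resultant A B
  set U := criticalSubgroup g hg ⊓ (criticalSubgroup f hf).comap (AddMonoidHom.mulLeft δ)
  have hUfin : Finite U := by
    have := finite_criticalSubgroup h2 hg hb
    exact Set.Finite.subset (Set.toFinite (criticalSubgroup g hg : Set L)) fun x hx ↦ hx.1
  have hUf : (U : Set L).Finite := hUfin
  have hF0 := derivative_X_mul_ne_zero h2 hf ha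
  have hdvd := resultant_sq_dvd_prod_critical_values (IsAlgClosed.splits _) hF0 hA hB hAB
  have hne (c : L) : C c - X * g ≠ 0 := by
    intro h
    apply derivative_X_mul_ne_zero h2 hg hb
    rw [← sub_eq_zero.1 h, derivative_C]
  have h0mem : (0 : L[X]) ∉
      (derivative (X * f)).roots.map fun v ↦ C ((X * f).eval v) - X * g := by
    rw [Multiset.mem_map]
    rintro ⟨v, -, hv⟩
    exact hne _ hv
  have hR : R ≠ 0 := by
    intro h
    apply Multiset.prod_ne_zero h0mem
    have h' : R ^ 2 ∣ _ := hdvd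
    rw [h] at h'
    simpa using h'
  have hroot {y : L} (hy : R.eval y = 0) : y ∈ U := by
    obtain ⟨hGy, x, hx, hxy⟩ := exists_singular_of_resultant_eval_eq_zero hA hB hAB hy
    have hxV := (mem_criticalSubgroup (hf := hf)).2 hx
    have hyW := (mem_criticalSubgroup (hf := hg)).2 hGy
    refine ⟨hyW, ?_⟩
    change δ * y ∈ criticalSubgroup f hf
    obtain h | h := hcrit hxV hyW hxy
    · rwa [← h]
    · rw [← neg_mem_iff, ← h]
      exact hxV
  have hcount {y : L} (hy : y ∈ U) : R.rootMultiplicity y ≤ ({y, -y} : Finset L).card := by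
    have h1 := Multiset.count_le_of_le y (roots.le_of_dvd (Multiset.prod_ne_zero h0mem) hdvd)
    rw [roots_pow, Multiset.count_nsmul, count_roots, roots_multiset_prod _ h0mem,
      Multiset.count_bind, Multiset.map_map] at h1
    have hnd := nodup_roots (separable_derivative_X_mul h2 hf ha)
    have h3 : (Multiset.map (Multiset.count y ∘ roots ∘ fun v ↦ C ((X * f).eval v) - X * g)
        (derivative (X * f)).roots).sum ≤ 2 * ({δ * y, -(δ * y)} : Finset L).card := by
      rw [← Multiset.dedup_eq_self.2 hnd]
      change ∑ v ∈ (derivative (X * f)).roots.toFinset,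
        Multiset.count y (C ((X * f).eval v) - X * g).roots ≤ _
      calc _ ≤ ∑ v ∈ (derivative (X * f)).roots.toFinset,
            if v ∈ ({δ * y, -(δ * y)} : Finset L) then 2 else 0 := by
            refine Finset.sum_le_sum fun v hv ↦ ?_
            rw [count_roots]
            split_ifs with h
            · exact rootMultiplicity_C_sub_X_mul_le_two h2 hg hb _ _
            · rw [nonpos_iff_eq_zero]
              refine rootMultiplicity_eq_zero fun hr ↦ h ?_
              have hv' : v ∈ criticalSubgroup f hf := by
                rw [mem_criticalSubgroup]
                exact (mem_roots hF0).1 (Multiset.mem_toFinset.1 hv)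
              simpa using hcrit hv' hy.1 (by simpa [sub_eq_zero] using hr)
        _ ≤ _ := by
            rw [Finset.sum_ite_mem, Finset.sum_const, smul_eq_mul, mul_comm]
            gcongr
            exact Finset.inter_subset_right
    have h4 : ({δ * y, -(δ * y)} : Finset L).card ≤ ({y, -y} : Finset L).card := by
      have : ({δ * y, -(δ * y)} : Finset L) = ({y, -y} : Finset L).image (δ * ·) := by simp
      rw [this]
      exact Finset.card_image_le
    have h5 : 2 * R.rootMultiplicity y ≤ _ := h1.trans (le_of_eq_of_le (by rfl) h3)
    omega
  calc R.natDegree = R.roots.card := (splits_iff_card_roots.1 (IsAlgClosed.splits R)).symm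
    _ = ∑ y ∈ R.roots.toFinset, R.roots.count y := (Multiset.toFinset_sum_count_eq _).symm
    _ ≤ ∑ y ∈ hUf.toFinset, R.roots.count y := by
        refine Finset.sum_le_sum_of_subset fun y hy ↦ ?_
        rw [Set.Finite.mem_toFinset]
        exact hroot (by simpa [hR] using hy)
    _ < ∑ y ∈ hUf.toFinset, 2 := by
        have hle (y) (hy : y ∈ hUf.toFinset) : R.roots.count y ≤ ({y, -y} : Finset L).card := by
          rw [count_roots]
          exact hcount ((Set.Finite.mem_toFinset _).1 hy)
        refine Finset.sum_lt_sum (fun y hy ↦ (hle y hy).trans Finset.card_le_two)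
          ⟨0, (Set.Finite.mem_toFinset _).2 U.zero_mem, ?_⟩
        refine (hle 0 ((Set.Finite.mem_toFinset _).2 U.zero_mem)).trans_lt ?_
        simp
    _ = 2 * Nat.card U := by
        rw [Finset.sum_const, smul_eq_mul, mul_comm, ← Set.ncard_eq_toFinset_card _ hUf]
        rfl

theorem not_mul_le_of_lt_two_mul {u v D M : ℕ} (hM : 3 * u + 1 ≤ M) (huv : u ≤ v)
    (hD : D < 2 * u) : ¬ M * v ≤ (v + 1) * D := by
  intro h
  have h1 : (3 * u + 1) * v ≤ (v + 1) * D := (Nat.mul_le_mul_right v hM).trans h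
  have h2 : (v + 1) * (D + 1) ≤ (v + 1) * (2 * u) := Nat.mul_le_mul_left _ hD
  nlinarith [Nat.zero_le (u * v)]

section Reducibility

variable {L : Type*} [Field L] {f g : L[X]}

theorem exists_scaling_of_mul_eq [IsAlgClosed L] (h2 : (2 : L) ≠ 0)
    (hf : ∀ x y, f.eval (x + y) = f.eval x + f.eval y)
    (hg : ∀ x y, g.eval (x + y) = g.eval x + g.eval y) (ha : (derivative f).eval 0 ≠ 0)
    (hb : (derivative g).eval 0 ≠ 0) (hmon : (X * f).Monic) (hdeg : f.natDegree ≤ g.natDegree)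
    {A B : L[X][X]} (hA : A.Monic) (hB : B.Monic) (hA0 : A.natDegree ≠ 0) (hB0 : B.natDegree ≠ 0)
    (hAB : A * B = (X * f).map C - C (X * g)) :
    ∃ δ : L, δ ≠ 0 ∧ g = C δ * f.comp (C δ * X) := by
  have : Infinite L := IsAlgClosed.instInfinite
  obtain ⟨δ, hδ⟩ := IsAlgClosed.exists_pow_nat_eq
    ((derivative g).eval 0 / (derivative f).eval 0) two_pos
  rw [eq_div_iff ha, eq_comm] at hδ
  have hδ0 : δ ≠ 0 := by
    rintro rfl
    exact hb (by simpa using hδ)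
  refine ⟨δ, hδ0, ?_⟩
  have hf0 : f ≠ 0 := by rintro rfl; simp at ha
  have hg0 : g ≠ 0 := by rintro rfl; simp at hb
  have hV := finite_criticalSubgroup h2 hf ha
  have hW := finite_criticalSubgroup h2 hg hb
  have hlt := natDegree_resultant_lt h2 hf hg ha hb hδ hA hB hAB
  set U := criticalSubgroup g hg ⊓ (criticalSubgroup f hf).comap (AddMonoidHom.mulLeft δ)
  have hUW : U ≤ criticalSubgroup g hg := inf_le_left
  have hNF : (X * f).natDegree = f.natDegree + 1 := natDegree_X_mul hf0
  have hNG : (X * g).natDegree = g.natDegree + 1 := natDegree_X_mul hg0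
  have hN : ((X * f).natDegree : L) ≠ 0 := by
    have h : (derivative (X * f)).coeff f.natDegree ≠ 0 := by
      rw [← natDegree_derivative_X_mul_of_eval_add h2 hf ha]
      exact leadingCoeff_ne_zero.2 (derivative_X_mul_ne_zero h2 hf ha)
    rw [coeff_derivative, ← hNF, hmon.coeff_natDegree, one_mul] at h
    rw [hNF]
    exact_mod_cast h
  have hle := natDegree_mul_le_natDegree_resultant hmon hN (by omega) hA hB hAB
  have hsum : A.natDegree + B.natDegree = f.natDegree + 1 := by
    rw [← hA.natDegree_mul hB, hAB, natDegree_sub_C, natDegree_map_eq_of_injective C_injective,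
      hNF]
  have hcV := card_criticalSubgroup h2 hf ha
  have hcW := card_criticalSubgroup h2 hg hb
  have hUV : Nat.card U ≤ Nat.card (criticalSubgroup f hf) := by
    refine Nat.card_le_card_of_injective
      (fun x : U ↦ (⟨δ * x, x.2.2⟩ : criticalSubgroup f hf)) fun x y hxy ↦ ?_
    exact Subtype.ext (mul_left_cancel₀ hδ0 (congrArg Subtype.val hxy))
  have hUeq : U = criticalSubgroup g hg := by
    obtain ⟨j, hj⟩ := AddSubgroup.card_dvd_of_le hUW
    have hodd := odd_card_criticalSubgroup h2 hg hb
    rw [hj] at hodd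
    obtain ⟨i, rfl⟩ := (Nat.odd_mul.1 hodd).2
    obtain rfl | hi := Nat.eq_zero_or_pos i
    · exact AddSubgroup.eq_of_le_of_card_ge hUW (by omega)
    · exfalso
      obtain ⟨r, hr⟩ := Nat.exists_eq_succ_of_ne_zero hA0
      obtain ⟨s, hs⟩ := Nat.exists_eq_succ_of_ne_zero hB0
      set D := (resultant A B).natDegree
      rw [hNF, hNG, ← hcW, hj, ← hsum, hr, hs] at hle
      rw [hcV] at hUV
      have hv : f.natDegree = r + s + 1 := by omega
      set u := Nat.card U
      have hrs : r + s + 1 ≤ r.succ * s.succ := by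
        simp only [Nat.succ_eq_add_one]
        nlinarith [Nat.zero_le (r * s)]
      refine not_mul_le_of_lt_two_mul (M := u * (2 * i + 1) + 1) (by nlinarith) (hUV.trans_eq hv)
        hlt ?_
      calc _ ≤ _ := Nat.mul_le_mul_left _ hrs
        _ ≤ _ := hle
        _ = _ := by rw [Nat.succ_add, Nat.add_succ]
  have hcomp0 : (derivative (X * f)).comp (C δ * X) ≠ 0 := by
    rw [Ne, comp_C_mul_X_eq_zero_iff (mem_nonZeroDivisors_of_ne_zero hδ0)]
    exact derivative_X_mul_ne_zero h2 hf ha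
  have hdvd : derivative (X * g) ∣ (derivative (X * f)).comp (C δ * X) := by
    refine (IsAlgClosed.splits _).dvd_of_roots_le_roots (derivative_X_mul_ne_zero h2 hg hb) ?_
    rw [Multiset.le_iff_subset (nodup_roots (separable_derivative_X_mul h2 hg hb))]
    intro y hy
    have hyU : y ∈ U := by
      rw [hUeq, mem_criticalSubgroup]
      exact (mem_roots'.1 hy).2
    refine mem_roots'.2 ⟨hcomp0, ?_⟩
    rw [IsRoot, eval_comp, eval_C_mul, eval_X]
    exact (mem_criticalSubgroup (hf := hf)).1 hyU.2
  obtain ⟨q, hq⟩ := hdvd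
  have hq0 : q ≠ 0 := by
    rintro rfl
    exact hcomp0 (by rw [hq, mul_zero])
  have hqdeg : q.natDegree = 0 := by
    have h := congrArg natDegree hq
    rw [natDegree_mul (derivative_X_mul_ne_zero h2 hg hb) hq0, natDegree_comp,
      natDegree_C_mul_X _ hδ0, natDegree_derivative_X_mul_of_eval_add h2 hf ha,
      natDegree_derivative_X_mul_of_eval_add h2 hg hb] at h
    omega
  obtain ⟨c, rfl⟩ := natDegree_eq_zero.1 hqdeg
  have hc : δ * c = 1 := by
    have h := congrArg derivative hq
    rw [derivative_comp, derivative_C_mul_X, derivative_mul (f := derivative (X * g)),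
      derivative_C, mul_zero, add_zero,
      derivative_derivative_X_mul_of_eval_add hf, derivative_derivative_X_mul_of_eval_add hg,
      C_comp, ← C_mul, ← C_mul, C_inj, hδ] at h
    exact mul_left_cancel₀ (mul_ne_zero (mul_ne_zero h2 ha) hδ0) (by linear_combination -h)
  rw [derivative_X_mul_of_eval_add hf, derivative_X_mul_of_eval_add hg, hδ, add_comp, mul_comp,
    C_comp, X_comp, C_mul, C_pow] at hq
  have hc' : C δ * C c = 1 := by rw [← C_mul, hc, C_1]
  linear_combination (-C δ) * hq - (g + C δ ^ 2 * C ((derivative f).eval 0) * X) * hc'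

theorem monic_map_C_sub_C {F G : L[X]} (hF : F.Monic) (hF0 : F.natDegree ≠ 0) :
    (F.map C - C G).Monic := by
  refine (hF.map C).sub_of_left (degree_C_le.trans_lt ?_)
  rw [degree_map_eq_of_injective C_injective]
  exact natDegree_pos_iff_degree_pos.1 (Nat.pos_of_ne_zero hF0)

theorem irreducible_C_mul_iff {c : L} (hc : c ≠ 0) (f g : L[X]) :
    Irreducible ((X * (C c * f)).map C - C (X * (C c * g)) : L[X][X]) ↔
      Irreducible ((X * f).map C - C (X * g) : L[X][X]) := by
  have h : ((X * (C c * f)).map C - C (X * (C c * g)) : L[X][X]) =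
      C (C c) * ((X * f).map C - C (X * g)) := by
    simp only [Polynomial.map_mul, map_X, map_C, C_mul]
    ring
  rw [h]
  exact irreducible_isUnit_mul (isUnit_C.2 (isUnit_C.2 hc.isUnit))

theorem monic_X_mul_C_inv_leadingCoeff_mul (hf : f ≠ 0) :
    (X * (C f.leadingCoeff⁻¹ * f)).Monic := by
  rw [mul_comm (C _)]
  exact monic_X.mul (monic_mul_leadingCoeff_inv hf)

theorem exists_scaling_of_not_irreducible_of_natDegree_le [IsAlgClosed L] (h2 : (2 : L) ≠ 0)
    (hf : ∀ x y, f.eval (x + y) = f.eval x + f.eval y)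
    (hg : ∀ x y, g.eval (x + y) = g.eval x + g.eval y) (ha : (derivative f).eval 0 ≠ 0)
    (hb : (derivative g).eval 0 ≠ 0) (hdeg : f.natDegree ≤ g.natDegree)
    (hirr : ¬ Irreducible ((X * f).map C - C (X * g) : L[X][X])) :
    ∃ δ : L, δ ≠ 0 ∧ g = C δ * f.comp (C δ * X) := by
  have hf0 : f ≠ 0 := by rintro rfl; simp at ha
  set c := f.leadingCoeff⁻¹
  have hc : c ≠ 0 := inv_ne_zero (leadingCoeff_ne_zero.2 hf0)
  have hmon : (X * (C c * f)).Monic := monic_X_mul_C_inv_leadingCoeff_mul hf0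
  have hF0 : (X * (C c * f)).natDegree ≠ 0 := by
    rw [natDegree_X_mul (mul_ne_zero (C_ne_zero.2 hc) hf0)]
    omega
  have hP := monic_map_C_sub_C (G := X * (C c * g)) hmon hF0
  rw [← irreducible_C_mul_iff hc, hP.irreducible_iff_natDegree, not_and] at hirr
  have hP1 : (X * (C c * f)).map C - C (X * (C c * g)) ≠ 1 := by
    intro h
    apply hF0
    rw [← natDegree_map_eq_of_injective C_injective, ← natDegree_sub_C (a := X * (C c * g)), h,
      natDegree_one]
  have hirr' := hirr hP1
  push Not at hirr'
  obtain ⟨A, B, hA, hB, hAB, hA0, hB0⟩ := hirr'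
  obtain ⟨δ, hδ0, hδ⟩ := exists_scaling_of_mul_eq h2 (f := C c * f) (g := C c * g)
    (fun x y ↦ by simp [hf, mul_add]) (fun x y ↦ by simp [hg, mul_add])
    (by simpa [hc] using ha) (by simpa [hc] using hb) hmon
    (by rwa [natDegree_C_mul hc, natDegree_C_mul hc]) hA hB hA0 hB0 hAB
  refine ⟨δ, hδ0, mul_left_cancel₀ (C_ne_zero.2 hc) ?_⟩
  rw [hδ, mul_comp, C_comp]
  ring

theorem irreducible_neg_iff {R : Type*} [CommRing R] {a : R} :
    Irreducible (-a) ↔ Irreducible a := by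
  rw [neg_eq_neg_one_mul, irreducible_isUnit_mul isUnit_one.neg]

theorem exists_scaling_of_not_irreducible [IsAlgClosed L] (h2 : (2 : L) ≠ 0)
    (hf : ∀ x y, f.eval (x + y) = f.eval x + f.eval y)
    (hg : ∀ x y, g.eval (x + y) = g.eval x + g.eval y) (ha : (derivative f).eval 0 ≠ 0)
    (hb : (derivative g).eval 0 ≠ 0)
    (hirr : ¬ Irreducible ((X * f).map C - C (X * g) : L[X][X])) :
    ∃ δ : L, δ ≠ 0 ∧ g = C δ * f.comp (C δ * X) := by
  obtain hdeg | hdeg := le_total f.natDegree g.natDegree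
  · exact exists_scaling_of_not_irreducible_of_natDegree_le h2 hf hg ha hb hdeg hirr
  · have hswap : ¬ Irreducible ((X * g).map C - C (X * f) : L[X][X]) := by
      have h : Bivariate.swap ((X * g).map C - C (X * f) : L[X][X]) =
          -((X * f).map C - C (X * g)) := by
        rw [map_sub, Bivariate.swap_map_C, Bivariate.swap_C, neg_sub]
      rw [← MulEquiv.irreducible_iff (Bivariate.swap (R := L)), h]
      exact mt irreducible_neg_iff.1 hirr
    obtain ⟨δ, hδ0, hδ⟩ :=
      exists_scaling_of_not_irreducible_of_natDegree_le h2 hg hf hb ha hdeg hswap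
    refine ⟨δ⁻¹, inv_ne_zero hδ0, ?_⟩
    have h1 : C δ * (C δ⁻¹ * X) = (X : L[X]) := by
      rw [← mul_assoc, ← C_mul, mul_inv_cancel₀ hδ0, C_1, one_mul]
    rw [hδ, mul_comp, C_comp, comp_assoc, mul_comp, C_comp, X_comp, h1, comp_X, ← mul_assoc,
      ← C_mul, inv_mul_cancel₀ hδ0, C_1, one_mul]

theorem irreducible_of_irreducible_map {M : Type*} [Field M] (φ : L →+* M) (hf : f ≠ 0)
    (h : Irreducible ((X * f.map φ).map C - C (X * g.map φ) : M[X][X])) :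
    Irreducible ((X * f).map C - C (X * g) : L[X][X]) := by
  have hc : f.leadingCoeff⁻¹ ≠ 0 := inv_ne_zero (leadingCoeff_ne_zero.2 hf)
  rw [← irreducible_C_mul_iff hc]
  rw [← irreducible_C_mul_iff ((map_ne_zero φ).2 hc)] at h
  refine Monic.irreducible_of_irreducible_map (mapRingHom φ) _
    (monic_map_C_sub_C (monic_X_mul_C_inv_leadingCoeff_mul hf) ?_) ?_
  · rw [natDegree_X_mul (mul_ne_zero (C_ne_zero.2 hc) hf)]
    omega
  · convert h using 1
    simp [Polynomial.map_map, mapRingHom_comp_C]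

theorem not_irreducible_of_monic_dvd {R : Type*} [CommRing R] [IsDomain R] {P D : R[X]}
    (hD : D.Monic) (hD0 : D.natDegree ≠ 0) (hdeg : D.natDegree < P.natDegree) (h : D ∣ P) :
    ¬ Irreducible P := by
  rintro hP
  obtain ⟨q, rfl⟩ := h
  obtain hu | hu := hP.isUnit_or_isUnit rfl
  · exact hD0 (natDegree_eq_zero_of_isUnit hu)
  · rw [hD.natDegree_mul' hu.ne_zero, natDegree_eq_zero_of_isUnit hu] at hdeg
    omega

theorem X_sub_C_mul_X_sub_C_dvd {R : Type*} [CommRing R] [IsDomain R] {P : R[X]} {a b : R}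
    (hab : a ≠ b) (ha : P.eval a = 0) (hb : P.eval b = 0) : (X - C a) * (X - C b) ∣ P := by
  obtain ⟨q, rfl⟩ := dvd_iff_isRoot.2 ha
  refine mul_dvd_mul_left _ (dvd_iff_isRoot.2 ?_)
  rw [eval_mul, eval_sub, eval_X, eval_C] at hb
  exact (mul_eq_zero.1 hb).resolve_left (sub_ne_zero.2 hab.symm)

theorem eval_map_C_sub_C {R : Type*} [CommRing R] (F G r : R[X]) :
    (F.map C - C G).eval r = F.comp r - G := by
  rw [eval_sub, eval_C, eval_map]
  rfl

theorem comp_neg_of_eval_add [Infinite L] (hf : ∀ x y, f.eval (x + y) = f.eval x + f.eval y)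
    (r : L[X]) : f.comp (-r) = -f.comp r := by
  refine Polynomial.funext fun x ↦ ?_
  rw [eval_comp, eval_neg, eval_neg, eval_comp, eq_neg_iff_add_eq_zero, ← hf, neg_add_cancel,
    eval_zero_of_eval_add hf]

theorem X_sq_sub_C_dvd [Infinite L] (h2 : (2 : L) ≠ 0)
    (hf : ∀ x y, f.eval (x + y) = f.eval x + f.eval y) {δ : L} (hδ0 : δ ≠ 0)
    (hδ : g = C δ * f.comp (C δ * X)) :
    (X ^ 2 - C (C (δ ^ 2) * X ^ 2) : L[X][X]) ∣ (X * f).map C - C (X * g) := by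
  have h : (X ^ 2 - C (C (δ ^ 2) * X ^ 2) : L[X][X]) =
      (X - C (C δ * X)) * (X - C (-(C δ * X))) := by
    simp only [C_mul, C_pow, C_neg]
    ring
  rw [h]
  refine X_sub_C_mul_X_sub_C_dvd ?_ ?_ ?_
  · intro h
    rw [eq_neg_iff_add_eq_zero, ← two_mul, ← mul_assoc, mul_eq_zero, or_iff_left X_ne_zero,
      ← C_ofNat, ← C_mul, C_eq_zero] at h
    exact mul_ne_zero h2 hδ0 h
  · rw [eval_map_C_sub_C, mul_comp, X_comp, hδ]
    ring
  · rw [eval_map_C_sub_C, mul_comp, X_comp, comp_neg_of_eval_add hf, hδ]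
    ring

end Reducibility

theorem IsAdditive.eval_map_add {K L : Type*} [CommSemiring K] [CommSemiring L] {f : K[X]}
    (hf : IsAdditive f) (φ : K →+* L) (x y : L) :
    (f.map φ).eval (x + y) = (f.map φ).eval x + (f.map φ).eval y := by
  have h := congrArg (eval₂RingHom (eval₂RingHom φ x) y) hf
  have hφ : (eval₂RingHom (eval₂RingHom φ x) y).comp (algebraMap K K[X][X]) = φ := by
    ext
    simp
  rw [map_add, aeval_def, aeval_def, aeval_def, hom_eval₂, hom_eval₂, hom_eval₂, hφ] at h
  simpa [eval_map] using h

/-- Part (1) of the main theorem: for additive `f, g` with `f'(0)·g'(0) ≠ 0`, and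
`F := X·f(X)`, `G := Y·g(Y)`, the polynomial `F(X) - G(Y) ∈ K[X,Y]` (realized in `K[Y][X]`
as `(X·f).map C - C (X·g)`) is reducible iff `g(Y) = δ·f(δY)` for some nonzero `δ` in an
algebraic closure of `K` with moreover `deg f > 1` or `δ ∈ K`. -/
theorem statement0 {K : Type*} [Field K] (p : ℕ) [CharP K p] (hp : 2 < p)
    (f g : K[X]) (hf : IsAdditive f) (hg : IsAdditive g)
    (hfg : eval 0 (derivative f) * eval 0 (derivative g) ≠ 0) :
    ¬ Irreducible
        ((X * f).map (C : K →+* K[X]) - C (X * g) : Polynomial (Polynomial K)) ↔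
      ∃ δ : AlgebraicClosure K, δ ≠ 0 ∧
        g.map (algebraMap K (AlgebraicClosure K)) =
          C δ * (f.map (algebraMap K (AlgebraicClosure K))).comp (C δ * X) ∧
        (1 < f.natDegree ∨ δ ∈ (algebraMap K (AlgebraicClosure K)).range) := by
  have h2K : (2 : K) ≠ 0 := by
    intro h
    have := (CharP.cast_eq_zero_iff K p 2).1 (by exact_mod_cast h)
    exact absurd (Nat.le_of_dvd two_pos this) (by omega)
  obtain ⟨ha, hb⟩ := mul_ne_zero_iff.1 hfg
  set ι := algebraMap K (AlgebraicClosure K)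
  have hι : Function.Injective ι := ι.injective
  have h2 : (2 : AlgebraicClosure K) ≠ 0 := by
    rw [← map_ofNat ι]
    exact (map_ne_zero ι).2 h2K
  have hder (q : K[X]) : (derivative (q.map ι)).eval 0 = ι ((derivative q).eval 0) := by
    rw [derivative_map, eval_zero_map]
  have ha' : (derivative (f.map ι)).eval 0 ≠ 0 := by rwa [hder, _root_.map_ne_zero]
  have hb' : (derivative (g.map ι)).eval 0 ≠ 0 := by rwa [hder, _root_.map_ne_zero]
  have hf' := hf.eval_map_add ι
  have hg' := hg.eval_map_add ι
  have : Infinite (AlgebraicClosure K) := IsAlgClosed.instInfinite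
  have hf0 : f ≠ 0 := by rintro rfl; simp at ha
  have hfpos := natDegree_pos_of_eval_derivative_ne_zero ha
  have hdegP : ((X * f).map (C : K →+* K[X]) - C (X * g)).natDegree = f.natDegree + 1 := by
    rw [natDegree_sub_C, natDegree_map_eq_of_injective C_injective, natDegree_X_mul hf0]
  have hscale {δ : AlgebraicClosure K}
      (hδ : g.map ι = C δ * (f.map ι).comp (C δ * X)) :
      ι ((derivative g).eval 0) = δ ^ 2 * ι ((derivative f).eval 0) := by
    have h := congrArg (fun q ↦ (derivative q).eval 0) hδ
    simp only [hder, derivative_C_mul, derivative_comp, eval_mul, eval_C, derivative_X, mul_one,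
      eval_comp, eval_X, mul_zero] at h
    rw [h]
    ring
  constructor
  · intro hirr
    obtain ⟨δ, hδ0, hδ⟩ := exists_scaling_of_not_irreducible h2 hf' hg' ha' hb'
      (mt (irreducible_of_irreducible_map ι hf0) hirr)
    refine ⟨δ, hδ0, hδ, or_iff_not_imp_left.2 fun hd ↦ ?_⟩
    have hs := hscale hδ
    set a := (derivative f).eval 0
    set b := (derivative g).eval 0
    have hfX : f = C a * X := by
      apply map_injective ι hι
      rw [eq_C_mul_X_of_eval_add hf' (by rw [natDegree_map]; omega), hder]
      simp [a]
    have hgX : g = C b * X := by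
      apply map_injective ι hι
      rw [hδ, hfX]
      simp only [Polynomial.map_mul, map_C, map_X, mul_comp, C_comp, X_comp, hs, C_mul, C_pow]
      ring
    rw [← irreducible_C_mul_iff (inv_ne_zero ha), hfX, hgX, ← mul_assoc (C a⁻¹) (C a), ← C_mul,
      inv_mul_cancel₀ ha, C_1, one_mul] at hirr
    have hdeg : ((X * X).map C - C (X * (C a⁻¹ * (C b * X))) : K[X][X]).natDegree = 2 := by
      rw [natDegree_sub_C, natDegree_map_eq_of_injective C_injective, ← sq, natDegree_X_pow]
    have hmon : ((X * X).map C - C (X * (C a⁻¹ * (C b * X))) : K[X][X]).Monic :=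
      monic_map_C_sub_C (monic_X.mul monic_X) (by rw [← sq, natDegree_X_pow]; omega)
    rw [hmon.irreducible_iff_roots_eq_zero_of_degree_le_three hdeg.ge (by omega)] at hirr
    obtain ⟨u, hu⟩ := Multiset.exists_mem_of_ne_zero hirr
    have hu' := congrArg (eval 1) (mem_roots'.1 hu).2
    rw [eval_map_C_sub_C] at hu'
    simp only [mul_comp, X_comp, eval_sub, eval_mul, eval_C, eval_X, eval_zero, mul_one,
      one_mul] at hu'
    have hsq : δ ^ 2 = ι (u.eval 1) ^ 2 := by
      rw [← map_pow, sq (u.eval 1), sub_eq_zero.1 hu', map_mul, hs, map_inv₀]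
      field_simp [(map_ne_zero ι).2 ha]
    obtain h | h := sq_eq_sq_iff_eq_or_eq_neg.1 hsq
    · exact ⟨u.eval 1, h.symm⟩
    · exact ⟨-u.eval 1, by rw [map_neg, h]⟩
  · rintro ⟨δ, hδ0, hδ, hd | ⟨d, rfl⟩⟩
    · set e := (derivative g).eval 0 / (derivative f).eval 0
      have he : ι e = δ ^ 2 := by
        rw [map_div₀, hscale hδ, mul_div_cancel_right₀ _ ((map_ne_zero ι).2 ha)]
      have hDdeg : (X ^ 2 - C (C e * X ^ 2) : K[X][X]).natDegree = 2 := natDegree_X_pow_sub_C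
      have hDmon : (X ^ 2 - C (C e * X ^ 2) : K[X][X]).Monic := monic_X_pow_sub_C _ two_ne_zero
      refine not_irreducible_of_monic_dvd hDmon (by omega) (by omega) ?_
      rw [← map_dvd_map (mapRingHom ι) (map_injective ι hι) hDmon]
      convert X_sq_sub_C_dvd h2 hf' hδ0 hδ using 1
      · simp [he]
      · simp [Polynomial.map_map, mapRingHom_comp_C]
    · have hg : g = C d * f.comp (C d * X) := by
        apply map_injective ι hι
        rw [hδ]
        simp [map_comp]
      refine not_irreducible_of_monic_dvd (monic_X_sub_C (C d * X))
        (by rw [natDegree_X_sub_C]; omega) (by rw [natDegree_X_sub_C]; omega)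
        (dvd_iff_isRoot.2 ?_)
      rw [IsRoot, eval_map_C_sub_C, mul_comp, X_comp, hg]
      ring
end

section
/- Let K be a field of characteristic p > 2, let f, g ∈ K[X] be additive polynomials with f'(0)·g'(0) ≠ 0, and set F(X) := X·f(X) and G(X) := X·g(X). Suppose g(Y) = δ·f(δ·Y) for some nonzero element δ of an algebraic closure of K, and suppose deg(g) > 1. Then δ² ∈ K, and there exists a polynomial H ∈ K[X,Y], irreducible in K[X,Y], such that F(X) − G(Y) = (X² − δ²·Y²)·H(X,Y); that is, over the algebraic closure F(X) − G(Y) is the product of (X − δY), (X + δY), and the polynomial H which lies in K[X,Y] and is irreducible there. -/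
open Polynomial

namespace IsAdditive

variable {K : Type*}

theorem aeval_add [CommSemiring K] {f : K[X]} (hf : IsAdditive f) {A : Type*} [CommSemiring A]
    [Algebra K A] (x y : A) : aeval (x + y) f = aeval x f + aeval y f := by
  have h := congrArg (eval₂ ((aeval x : K[X] →ₐ[K] A) : K[X] →+* A) y) hf
  have key : ∀ q : K[X][X], eval₂ ((aeval x : K[X] →ₐ[K] A) : K[X] →+* A) y (aeval q f) =
      aeval (eval₂ ((aeval x : K[X] →ₐ[K] A) : K[X] →+* A) y q) f := by
    intro q
    rw [aeval_def, aeval_def, ← coe_eval₂RingHom, hom_eval₂]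
    congr 1
    ext r
    simp [IsScalarTower.algebraMap_apply K K[X] K[X][X]]
  rw [eval₂_add, key, key, key] at h
  simpa using h

theorem coeff_zero [CommRing K] {f : K[X]} (hf : IsAdditive f) : f.coeff 0 = 0 := by
  have h := hf.aeval_add (0 : K) 0
  rw [add_zero] at h
  simpa [coeff_zero_eq_eval_zero, coe_aeval_eq_eval] using h

theorem comp_neg_X [CommRing K] {f : K[X]} (hf : IsAdditive f) : f.comp (-X) = -f := by
  have h := hf.aeval_add (X : K[X]) (-X)
  rw [add_neg_cancel, aeval_X_left_apply, ← coeff_zero_eq_aeval_zero', hf.coeff_zero, map_zero]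
    at h
  exact (neg_eq_of_add_eq_zero_right h.symm).symm

theorem coeff_eq_zero_of_even [Field K] (h2 : (2 : K) ≠ 0) {f : K[X]} (hf : IsAdditive f)
    {k : ℕ} (hk : Even k) : f.coeff k = 0 := by
  have h := congrArg (coeff · k) hf.comp_neg_X
  rw [show (-X : K[X]) = C (-1) * X by simp] at h
  simp only [comp_C_mul_X_coeff, hk.neg_one_pow, mul_one, coeff_neg] at h
  have h' : 2 * f.coeff k = 0 := by linear_combination h
  exact (mul_eq_zero.mp h').resolve_left h2

theorem derivative_eq_C [CommRing K] {f : K[X]} (hf : IsAdditive f) :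
    derivative f = C (f.coeff 1) := by
  have key : ∀ q : K[X][X], aeval q f = (f.map (C : K →+* K[X])).comp q := by
    intro q
    rw [aeval_def, comp, eval₂_map]
    rfl
  have h := congrArg (fun r => eval 0 (derivative r)) hf
  simp only [key, derivative_comp, derivative_add, eval_add, eval_comp, derivative_C,
    derivative_X, derivative_map, eval_C, eval_X, zero_add, add_zero, zero_mul,
    one_mul] at h
  rw [eval_map, eval₂_C_X, eval_zero_map] at h
  rw [h, ← coeff_zero_eq_eval_zero, coeff_derivative]
  simp

end IsAdditive

/-- The substitution `A(X, Y) ↦ A(sY, Y)`, from `K[Y][X]` to `K[s][Y]`. The coefficient of `Y ^ k`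
in the image is the dehomogenization of the homogeneous component of `A` of degree `k`. -/
noncomputable def slopeSubst (K : Type*) [CommRing K] : K[X][X] →+* K[X][X] :=
  eval₂RingHom (mapRingHom C) (C X * X)

theorem slopeSubst_C {K : Type*} [CommRing K] (r : K[X]) : slopeSubst K (C r) = r.map C := by
  simp [slopeSubst]

theorem slopeSubst_X {K : Type*} [CommRing K] : slopeSubst K X = C X * X := by
  simp [slopeSubst]

theorem coeff_coeff_slopeSubst {K : Type*} [CommRing K] (A : K[X][X]) (k i : ℕ) :
    ((slopeSubst K A).coeff k).coeff i = if i ≤ k then (A.coeff i).coeff (k - i) else 0 := by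
  induction A using Polynomial.induction_on' with
  | add A B hA hB =>
    rw [map_add, coeff_add, coeff_add, hA, hB]
    split_ifs <;> simp
  | monomial n r =>
    have : slopeSubst K (monomial n r) = C (X ^ n) * (r.map C) * X ^ n := by
      simp [slopeSubst, mul_pow]
      ring
    rw [this, coeff_mul_X_pow', coeff_monomial]
    by_cases hin : i = n
    · subst hin
      split_ifs <;> simp_all [coeff_X_pow, -map_pow]
    · split_ifs <;> simp_all [coeff_X_pow, eq_comm, -map_pow]

theorem natDegree_coeff_slopeSubst_le {K : Type*} [CommRing K] (A : K[X][X]) (k : ℕ) :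
    ((slopeSubst K A).coeff k).natDegree ≤ k := by
  rw [natDegree_le_iff_coeff_eq_zero]
  intro i hi
  rw [coeff_coeff_slopeSubst, if_neg (by omega)]

theorem slopeSubst_injective (K : Type*) [CommRing K] : Function.Injective (slopeSubst K) := by
  rw [injective_iff_map_eq_zero]
  intro A hA
  ext i j
  have h := coeff_coeff_slopeSubst A (i + j) i
  simpa [hA] using h.symm

theorem isUnit_of_natDegree_slopeSubst_eq_zero {K : Type*} [Field K] {A : K[X][X]} (hA : A ≠ 0)
    (h : (slopeSubst K A).natDegree = 0) : IsUnit A := by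
  obtain ⟨r, hr⟩ := natDegree_eq_zero.mp h
  have hd := natDegree_coeff_slopeSubst_le A 0
  rw [← hr, coeff_C_zero, Nat.le_zero] at hd
  obtain ⟨c, rfl⟩ := natDegree_eq_zero.mp hd
  have hAc : A = C (C c) := by
    apply slopeSubst_injective K
    rw [← hr]
    simp [slopeSubst]
  subst hAc
  have hc : c ≠ 0 := by
    rintro rfl
    simp at hA
  exact (isUnit_C.mpr (isUnit_C.mpr hc.isUnit))

theorem coeff_X_mul_derivative_sub {R : Type*} [CommRing R] (B : R[X]) (n k : ℕ) :
    (X * derivative B - (n : R[X]) * B).coeff k = ((k : R) - n) * B.coeff k := by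
  rw [coeff_sub, coeff_natCast_mul]
  cases k with
  | zero => simp
  | succ k =>
    rw [coeff_X_mul, coeff_derivative]
    push_cast
    ring

theorem not_isCoprime_leadingCoeff_of_mul_add_mul_eq_C {K : Type*} [Field K] {A B : K[X][X]}
    (hA : 0 < A.natDegree) (hB : 0 < B.natDegree) (hBc : ∀ k, (B.coeff k).natDegree ≤ k)
    (hlc : B.leadingCoeff.natDegree = B.natDegree) {Q : K[X][X]} {c : K[X]} (hc : c ≠ 0)
    (h : A * (X * derivative B - (B.natDegree : K[X][X]) * B) + B * Q = C c) :
    ¬ IsCoprime A.leadingCoeff B.leadingCoeff := by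
  intro hcop
  have hCc : (C c : K[X][X]) ≠ 0 := C_ne_zero.mpr hc
  have hB0 : B ≠ 0 := ne_zero_of_natDegree_gt hB
  have not_dvd : ∀ D : K[X][X], 0 < D.natDegree → ¬ D ∣ C c := by
    intro D hD hdvd
    have := natDegree_le_of_dvd hdvd hCc
    rw [natDegree_C] at this
    omega
  set P := X * derivative B - (B.natDegree : K[X][X]) * B with hP
  have hP0 : P ≠ 0 := by
    intro h0
    rw [h0, mul_zero, zero_add] at h
    exact not_dvd B hB ⟨_, h.symm⟩
  have hQ0 : Q ≠ 0 := by
    intro h0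
    rw [h0, mul_zero, add_zero] at h
    exact not_dvd A hA ⟨_, h.symm⟩
  have hdeg : (C c : K[X][X]).degree < (B * Q).degree := by
    apply degree_lt_degree
    rw [natDegree_C, natDegree_mul hB0 hQ0]
    omega
  have hlead : A.leadingCoeff * P.leadingCoeff = -(B.leadingCoeff * Q.leadingCoeff) := by
    rw [← leadingCoeff_mul, ← leadingCoeff_mul, eq_sub_of_add_eq h,
      leadingCoeff_sub_of_degree_lt' hdeg]
  have hdvd : B.leadingCoeff ∣ P.leadingCoeff := by
    refine hcop.symm.dvd_of_dvd_mul_left ?_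
    rw [hlead]
    exact (dvd_mul_right _ _).neg_right
  have hle := natDegree_le_of_dvd hdvd (leadingCoeff_ne_zero.mpr hP0)
  have hPl : P.leadingCoeff = ((P.natDegree : K[X]) - B.natDegree) * B.coeff P.natDegree :=
    coeff_X_mul_derivative_sub B _ _
  have hPl0 := leadingCoeff_ne_zero.mpr hP0
  have hlt : P.natDegree < B.natDegree := by
    refine lt_of_le_of_ne (le_natDegree_of_ne_zero ?_) ?_
    · rw [hPl] at hPl0
      exact right_ne_zero_of_mul hPl0
    · intro he
      rw [hPl, he, sub_self, zero_mul] at hPl0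
      exact hPl0 rfl
  have hle' : P.leadingCoeff.natDegree ≤ P.natDegree := by
    rw [hPl, ← C_eq_natCast, ← C_eq_natCast, ← C_sub]
    exact (natDegree_C_mul_le _ _).trans (hBc _)
  omega

theorem slopeSubst_map_C {K : Type*} [CommRing K] (r : K[X]) (n : ℕ) :
    (slopeSubst K (r.map C)).coeff n = C (r.coeff n) * X ^ n := by
  ext i
  rw [coeff_coeff_slopeSubst, coeff_map, coeff_C_mul, coeff_X_pow, coeff_C]
  rcases lt_trichotomy i n with h | rfl | h
  · rw [if_pos h.le, if_neg (by omega), if_neg h.ne, mul_zero]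
  · simp
  · rw [if_neg (by omega), if_neg h.ne', mul_zero]

theorem natCast_mul_coeff_of_derivative_eq_C {K : Type*} [CommRing K] {f : K[X]} {a : K}
    (hf : derivative f = C a) (k : ℕ) : (k : K) * f.coeff k = if k = 1 then a else 0 := by
  cases k with
  | zero => simp
  | succ k =>
    have h := congrArg (coeff · k) hf
    simp only [coeff_derivative, coeff_C] at h
    rw [Nat.cast_succ, mul_comm, h]
    simp

theorem irreducible_of_mul_eq {K : Type*} [Field K] {f g : K[X]} {a d : K} {H : K[X][X]}
    (ha : a ≠ 0) (hf : derivative f = C a) (hg : derivative g = C (d * a))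
    (hdeg : 1 < f.natDegree) (hgdeg : g.natDegree = f.natDegree)
    (hH : (X * f).map (C : K →+* K[X]) - C (X * g) = (X ^ 2 - C (C d * X ^ 2)) * H) :
    Irreducible H := by
  set q := f.natDegree with hq
  have hfq : f.coeff q ≠ 0 := leadingCoeff_ne_zero.mpr (ne_zero_of_natDegree_gt hdeg)
  have hgq : g.coeff q ≠ 0 := by
    rw [← hgdeg]
    exact leadingCoeff_ne_zero.mpr (ne_zero_of_natDegree_gt (hdeg.trans_eq hgdeg.symm))
  have hqK : (q : K) = 0 := by
    have h := congrArg (coeff · (q - 1)) hf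
    simp only [coeff_derivative, coeff_C, if_neg (show q - 1 ≠ 0 by omega),
      Nat.sub_add_cancel hdeg.le] at h
    have h' := (mul_eq_zero.mp h).resolve_left hfq
    rwa [← Nat.cast_succ, Nat.succ_eq_add_one, Nat.sub_add_cancel hdeg.le] at h'
  set T := slopeSubst K ((X * f).map C - C (X * g)) with hT
  set W : K[X][X] := C (X ^ 2 - C d) * X ^ 2 with hW
  have hTW : T = W * slopeSubst K H := by
    rw [hT, hH, map_mul]
    congr 1
    simp only [hW, map_sub, map_pow, slopeSubst_C, slopeSubst_X, Polynomial.map_mul,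
      Polynomial.map_pow, map_C, map_X]
    ring
  have hTc : ∀ n, T.coeff n = C ((X * f).coeff n) * X ^ n - C ((X * g).coeff n) := by
    intro n
    rw [hT, map_sub, coeff_sub, slopeSubst_map_C, slopeSubst_C, coeff_map]
  have hTq : T.coeff (q + 1) = C (f.coeff q) * X ^ (q + 1) - C (g.coeff q) := by
    rw [hTc, coeff_X_mul, coeff_X_mul]
  have hTqdeg : (T.coeff (q + 1)).natDegree = q + 1 := by
    rw [hTq, natDegree_sub_C, natDegree_C_mul_X_pow _ _ hfq]
  have hTq0 : T.coeff (q + 1) ≠ 0 := by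
    apply ne_zero_of_natDegree_gt (n := 0)
    omega
  have hTdeg : T.natDegree = q + 1 := by
    refine le_antisymm (natDegree_le_iff_coeff_eq_zero.mpr ?_) (le_natDegree_of_ne_zero hTq0)
    intro n hn
    obtain ⟨k, rfl⟩ : ∃ k, n = k + 1 := ⟨n - 1, by omega⟩
    rw [hTc, coeff_X_mul, coeff_X_mul, coeff_eq_zero_of_natDegree_lt (p := f) (by omega),
      coeff_eq_zero_of_natDegree_lt (p := g) (by omega)]
    simp
  have hTsep : (T.coeff (q + 1)).Separable := by
    have h : T.coeff (q + 1) = C (f.coeff q) * (X ^ (q + 1) - C (g.coeff q / f.coeff q)) := by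
      rw [hTq, mul_sub, ← C_mul, mul_div_cancel₀ _ hfq]
    rw [h]
    refine (separable_X_pow_sub_C _ ?_ (div_ne_zero hgq hfq)).unit_mul
      (isUnit_C.mpr hfq.isUnit)
    simp [hqK]
  have hEuler : X * derivative T = T + W * C (C a) := by
    ext1 n
    rw [hW, mul_right_comm, ← C_mul, coeff_add, coeff_C_mul_X_pow]
    cases n with
    | zero => simp [hTc]
    | succ k =>
      rw [coeff_X_mul, coeff_derivative, hTc, coeff_X_mul, coeff_X_mul]
      have hfk := natCast_mul_coeff_of_derivative_eq_C hf k
      have hgk := natCast_mul_coeff_of_derivative_eq_C hg k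
      have key : (k : K[X]) * (C (f.coeff k) * X ^ (k + 1) - C (g.coeff k)) =
          if 2 = k + 1 then (X ^ 2 - C d) * C a else 0 := by
        rw [← C_eq_natCast, mul_sub, ← mul_assoc, ← C_mul, ← C_mul, hfk, hgk]
        by_cases hk : k = 1
        · subst hk
          simp
          ring
        · rw [if_neg hk, if_neg hk, if_neg (by omega)]
          simp
      simp only [eq_comm (a := k + 1)] at key ⊢
      rw [← key]
      ring
  have hd0 : (X ^ 2 - C d : K[X]) ≠ 0 := X_pow_sub_C_ne_zero two_pos d
  have hW0 : W ≠ 0 := mul_ne_zero (C_ne_zero.mpr hd0) (pow_ne_zero _ X_ne_zero)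
  have hWdeg : W.natDegree = 2 := natDegree_C_mul_X_pow _ _ hd0
  have hWlc : W.leadingCoeff = X ^ 2 - C d := leadingCoeff_C_mul_X_pow _ _
  have hT0 : T ≠ 0 := by
    rintro h
    simp [h] at hTq0
  have hH0 : slopeSubst K H ≠ 0 := by
    rintro h
    exact hT0 (by rw [hTW, h, mul_zero])
  have hHdeg : (slopeSubst K H).natDegree + 1 = q := by
    have h := congrArg natDegree hTW
    rw [natDegree_mul hW0 hH0, hTdeg, hWdeg] at h
    omega
  have hlc : T.coeff (q + 1) = (X ^ 2 - C d) * (slopeSubst K H).leadingCoeff := by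
    rw [← hTdeg, coeff_natDegree, hTW, leadingCoeff_mul, hWlc]
  have hlcdeg : (slopeSubst K H).leadingCoeff.natDegree + 1 = q := by
    have h := congrArg natDegree hlc
    rw [natDegree_mul hd0 (leadingCoeff_ne_zero.mpr hH0), hTqdeg, natDegree_X_pow_sub_C] at h
    omega
  have hlcsep : (slopeSubst K H).leadingCoeff.Separable := by
    rw [hlc] at hTsep
    exact hTsep.of_mul_right
  have hEulerH : X * derivative (slopeSubst K H) + slopeSubst K H = C (C a) := by
    apply mul_left_cancel₀ hW0
    have hWd : X * derivative W = 2 * W := by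
      rw [hW, derivative_C_mul, derivative_X_pow, Nat.cast_ofNat, map_ofNat]
      ring
    rw [hTW, derivative_mul] at hEuler
    linear_combination hEuler - slopeSubst K H * hWd
  refine irreducible_iff.mpr ⟨fun hu => ?_, ?_⟩
  · have := natDegree_eq_zero_of_isUnit (hu.map (slopeSubst K))
    omega
  rintro A B rfl
  by_contra! hAB
  rw [map_mul] at *
  have hA0 := left_ne_zero_of_mul hH0
  have hB0 := right_ne_zero_of_mul hH0
  have hAdeg : 0 < (slopeSubst K A).natDegree := Nat.pos_of_ne_zero fun h =>
    hAB.1 (isUnit_of_natDegree_slopeSubst_eq_zero (by rintro rfl; simp at hA0) h)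
  have hBdeg : 0 < (slopeSubst K B).natDegree := Nat.pos_of_ne_zero fun h =>
    hAB.2 (isUnit_of_natDegree_slopeSubst_eq_zero (by rintro rfl; simp at hB0) h)
  rw [natDegree_mul hA0 hB0] at hHdeg
  rw [leadingCoeff_mul] at hlcsep hlcdeg
  rw [natDegree_mul (leadingCoeff_ne_zero.mpr hA0) (leadingCoeff_ne_zero.mpr hB0)] at hlcdeg
  have hAle := natDegree_coeff_slopeSubst_le A (slopeSubst K A).natDegree
  have hBle := natDegree_coeff_slopeSubst_le B (slopeSubst K B).natDegree
  rw [coeff_natDegree] at hAle hBle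
  refine not_isCoprime_leadingCoeff_of_mul_add_mul_eq_C hAdeg hBdeg
    (natDegree_coeff_slopeSubst_le B) (by omega) (C_ne_zero.mpr ha)
    (Q := X * derivative (slopeSubst K A) -
      ((slopeSubst K A).natDegree : K[X][X]) * slopeSubst K A) ?_ hlcsep.isCoprime
  have hsum : ((slopeSubst K A).natDegree : K[X][X]) + (slopeSubst K B).natDegree + 1 = 0 := by
    have h : ((q : K[X][X])) = 0 := by
      rw [← C_eq_natCast, ← C_eq_natCast, hqK, C_0, C_0]
    rw [← h, ← hHdeg]
    push_cast
    ring
  rw [derivative_mul] at hEulerH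
  linear_combination hEulerH - slopeSubst K A * slopeSubst K B * hsum

theorem dvd_map_C_sub_C_of_coeff {K : Type*} [CommRing K] {f g : K[X]} {d : K}
    (hf : ∀ k, Even k → f.coeff k = 0) (hg : ∀ k, Even k → g.coeff k = 0)
    (hfg : ∀ m, g.coeff (2 * m + 1) = d ^ (m + 1) * f.coeff (2 * m + 1)) :
    (X ^ 2 - C (C d * X ^ 2)) ∣ (X * f).map (C : K →+* K[X]) - C (X * g) := by
  set N := max f.natDegree g.natDegree + 1 with hN
  rw [f.as_sum_range' N (by omega), g.as_sum_range' N (by omega), Finset.mul_sum, Finset.mul_sum,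
    Polynomial.map_sum, map_sum, ← Finset.sum_sub_distrib]
  refine Finset.dvd_sum fun k _ => ?_
  rcases Nat.even_or_odd' k with ⟨m, rfl | rfl⟩
  · rw [hf _ (even_two_mul m), hg _ (even_two_mul m)]
    simp
  · have h : (X * monomial (2 * m + 1) (f.coeff (2 * m + 1))).map (C : K →+* K[X]) -
        C (X * monomial (2 * m + 1) (g.coeff (2 * m + 1))) =
        ((X ^ 2) ^ (m + 1) - C (C d * X ^ 2) ^ (m + 1)) * C (C (f.coeff (2 * m + 1))) := by
      rw [hfg, ← C_mul_X_pow_eq_monomial, ← C_mul_X_pow_eq_monomial]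
      simp only [Polynomial.map_mul, Polynomial.map_pow, map_C, map_X, C_mul, C_pow]
      ring
    rw [h]
    exact (sub_dvd_pow_sub_pow _ _ _).mul_right _

/-- Part (2) of the main theorem: if `g(Y) = δ·f(δY)` for some nonzero `δ` in an algebraic
closure of `K` and `deg g > 1`, then `δ² ∈ K` (say `δ² = d` with `d ∈ K`) and
`F(X) - G(Y) = (X² - δ²Y²)·H(X,Y)` with `H ∈ K[X,Y]` irreducible.  Here `F(X) - G(Y)` is
realized in `K[Y][X]` as `(X·f).map C - C (X·g)`, and `X² - δ²Y²` as `X^2 - C (C d * X^2)`. -/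
theorem statement1 {K : Type*} [Field K] (p : ℕ) [CharP K p] (hp : 2 < p)
    (f g : K[X]) (hf : IsAdditive f) (hg : IsAdditive g)
    (hfg : eval 0 (derivative f) * eval 0 (derivative g) ≠ 0)
    (δ : AlgebraicClosure K) (hδ : δ ≠ 0)
    (hgf : g.map (algebraMap K (AlgebraicClosure K)) =
      C δ * (f.map (algebraMap K (AlgebraicClosure K))).comp (C δ * X))
    (hdeg : 1 < g.natDegree) :
    ∃ d : K, algebraMap K (AlgebraicClosure K) d = δ ^ 2 ∧
      ∃ H : Polynomial (Polynomial K), Irreducible H ∧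
        (X * f).map (C : K →+* K[X]) - C (X * g) =
          (X ^ 2 - C (C d * X ^ 2)) * H := by
  have h2 : (2 : K) ≠ 0 := by
    intro h
    have hdvd : p ∣ 2 := (CharP.cast_eq_zero_iff K p 2).mp (by exact_mod_cast h)
    exact absurd (Nat.le_of_dvd two_pos hdvd) (by omega)
  rw [hf.derivative_eq_C, hg.derivative_eq_C, eval_C, eval_C] at hfg
  have hf1 : f.coeff 1 ≠ 0 := left_ne_zero_of_mul hfg
  have hcoeff : ∀ k, algebraMap K (AlgebraicClosure K) (g.coeff k) =
      δ ^ (k + 1) * algebraMap K (AlgebraicClosure K) (f.coeff k) := by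
    intro k
    have h := congrArg (coeff · k) hgf
    simp only [coeff_map, coeff_C_mul, comp_C_mul_X_coeff] at h
    rw [h]
    ring
  have hgdeg : g.natDegree = f.natDegree := by
    have h := congrArg natDegree hgf
    rwa [natDegree_map, natDegree_C_mul hδ, natDegree_comp, natDegree_map, natDegree_C_mul_X _ hδ,
      mul_one] at h
  have hd : algebraMap K (AlgebraicClosure K) (g.coeff 1 / f.coeff 1) = δ ^ 2 := by
    rw [map_div₀, hcoeff, mul_div_cancel_right₀ _ (by simpa using hf1)]
  refine ⟨g.coeff 1 / f.coeff 1, hd, ?_⟩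
  obtain ⟨H, hH⟩ := dvd_map_C_sub_C_of_coeff (d := g.coeff 1 / f.coeff 1)
    (fun _ => hf.coeff_eq_zero_of_even h2) (fun _ => hg.coeff_eq_zero_of_even h2) (fun m => by
      apply (algebraMap K (AlgebraicClosure K)).injective
      rw [hcoeff, map_mul, map_pow, hd]
      ring)
  refine ⟨H, irreducible_of_mul_eq hf1 hf.derivative_eq_C ?_ (hgdeg ▸ hdeg) hgdeg hH, hH⟩
  rw [div_mul_cancel₀ _ hf1, hg.derivative_eq_C]
end

section
/- Let K be a field, and let F, G ∈ K[X] be polynomials whose derivatives are nonzero. Then there exist polynomials F₁, F₂, G₁, G₂ ∈ K[X] such that: (i) F = F₁ ∘ F₂ and G = G₁ ∘ G₂; (ii) the irreducible factors of F(X) − G(Y) in K[X,Y] are precisely (up to associates) the polynomials H(F₂(X), G₂(Y)) where H(X,Y) ranges over the irreducible factors of F₁(X) − G₁(Y) in K[X,Y]; and (iii) the splitting field of F₁(X) − t over K(t) equals the splitting field of G₁(X) − t over K(t), where t is transcendental over K. -/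
open Polynomial

/-- Substitution `H(X,Y) ↦ H(F₂(X), G₂(Y))` on bivariate polynomials, realized in `K[Y][X]`:
the outer variable `X` is replaced by `F₂(X)` and the inner variable `Y` by `G₂(Y)`. -/
noncomputable def substXY {K : Type*} [CommSemiring K] (F₂ G₂ : Polynomial K)
    (H : Polynomial (Polynomial K)) : Polynomial (Polynomial K) :=
  Polynomial.eval₂
    ((Polynomial.C : Polynomial K →+* Polynomial (Polynomial K)).comp
      (Polynomial.aeval G₂).toRingHom)
    (F₂.map Polynomial.C) H

namespace Polynomial

theorem exists_eq_sum_comp_mul_X_pow {R : Type*} [CommRing R] [Nontrivial R] {p : R[X]}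
    (hp : p.Monic) (hd : 0 < p.natDegree) (A : R[X]) :
    ∃ c : ℕ → R[X], A = ∑ j ∈ Finset.range p.natDegree, (c j).comp p * X ^ j := by
  induction hn : A.natDegree using Nat.strong_induction_on generalizing A with
  | _ n ih =>
    have hlt : (A %ₘ p).natDegree < p.natDegree := natDegree_modByMonic_lt A hp (by
      rintro rfl; simp at hd)
    have hr := (A %ₘ p).as_sum_range' _ hlt
    by_cases hA : A.natDegree < p.natDegree
    · refine ⟨fun j ↦ C (A.coeff j), ?_⟩
      conv_lhs => rw [A.as_sum_range' _ hA]
      simp [C_mul_X_pow_eq_monomial]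
    · obtain ⟨c, hc⟩ := ih _ (by rw [natDegree_divByMonic A hp]; omega) (A /ₘ p) rfl
      refine ⟨fun j ↦ X * c j + C ((A %ₘ p).coeff j), ?_⟩
      conv_lhs => rw [← modByMonic_add_div A p, hc, hr]
      simp only [add_comp, mul_comp, X_comp, C_comp, add_mul, Finset.sum_add_distrib,
        Finset.mul_sum, mul_assoc, C_mul_X_pow_eq_monomial]
      rw [add_comm]

theorem natDegree_coeff_zero_of_dvd_map_C_sub_C {K : Type*} [Field K] {F : K[X]}
    (hF : F.natDegree ≠ 0) {P : K[X][X]} (hP : P.Monic) (hdvd : P ∣ F.map C - C F) :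
    (P.coeff 0).natDegree = P.natDegree := by
  let φ : K[X][X] →+* K[X][X] :=
    eval₂RingHom ((compRingHom (C (1 - X) * X)).comp (mapRingHom C)) (C X * X)
  have hφ : φ (F.map C - C F) =
      (F.map C).comp (C X * X) - (F.map C).comp (C (1 - X) * X) := by
    rw [map_sub]
    congr 1
    · simp only [φ, coe_eval₂RingHom, eval₂_map, comp]
      congr 1
      ext
      simp
    · simp [φ]
  have hcoeff (m : ℕ) : (φ (F.map C - C F)).coeff m =
      C (F.coeff m) * (X ^ m - (1 - X) ^ m) := by
    rw [hφ, coeff_sub, comp_C_mul_X_coeff, comp_C_mul_X_coeff, coeff_map, mul_sub]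
  set n := F.natDegree with hn
  have hFn : F.coeff n ≠ 0 := by
    rw [hn, coeff_natDegree, leadingCoeff_ne_zero]
    rintro rfl
    simp [hn] at hF
  have hne0 : ((φ (F.map C - C F)).coeff n).eval 0 ≠ 0 := by
    rw [hcoeff]; simp [hF, hFn]
  have hne1 : ((φ (F.map C - C F)).coeff n).eval 1 ≠ 0 := by
    rw [hcoeff]; simp [hF, hFn]
  have hdeg : (φ (F.map C - C F)).natDegree = n := by
    refine natDegree_eq_of_le_of_coeff_ne_zero (natDegree_le_iff_coeff_eq_zero.2 fun m hm ↦ ?_)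
      (fun h ↦ hne0 (by rw [h, eval_zero]))
    rw [hcoeff, coeff_eq_zero_of_natDegree_lt hm, C_0, zero_mul]
  have hlc : (φ P).leadingCoeff ∣ (φ (F.map C - C F)).coeff n := by
    obtain ⟨Q, hQ⟩ := _root_.map_dvd φ hdvd
    rw [← hdeg, coeff_natDegree, hQ, leadingCoeff_mul]
    exact dvd_mul_right _ _
  have h0 : (φ P).map (evalRingHom 0) = P.coeff 0 := by
    have : (mapRingHom (evalRingHom 0)).comp φ = (constantCoeff : K[X][X] →+* K[X]) := by
      ext <;> simp [φ]
    exact congr($this P)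
  have h1 : (φ P).map (evalRingHom 1) = P.map (evalRingHom 0) := by
    have : (mapRingHom (evalRingHom 1)).comp φ = mapRingHom (evalRingHom (0 : K)) := by
      ext <;> simp [φ]
    exact congr($this P)
  rw [← h0, natDegree_map_of_leadingCoeff_ne_zero, ← natDegree_map_of_leadingCoeff_ne_zero
    (evalRingHom 1), h1, hP.natDegree_map]
  · intro h
    obtain ⟨r, hr⟩ := hlc
    rw [hr, eval_mul] at hne1
    exact hne1 (by simp_all)
  · intro h
    obtain ⟨r, hr⟩ := hlc
    rw [hr, eval_mul] at hne0
    exact hne0 (by simp_all)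

theorem leadingCoeff_map_C_sub_C {R : Type*} [CommRing R] {F : R[X]} (hF : F.natDegree ≠ 0)
    (G : R[X]) : (F.map C - C G).leadingCoeff = C F.leadingCoeff := by
  rw [leadingCoeff_sub_of_degree_lt, leadingCoeff_map_of_injective C_injective]
  refine degree_C_le.trans_lt ?_
  rw [degree_map_eq_of_injective C_injective]
  exact natDegree_pos_iff_degree_pos.1 (Nat.pos_of_ne_zero hF)

theorem monic_C_inv_mul_map_C_sub_C {K : Type*} [Field K] {F : K[X]} (hF : F.natDegree ≠ 0)
    (G : K[X]) : (C (C F.leadingCoeff⁻¹) * (F.map C - C G)).Monic := by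
  have hlc : F.leadingCoeff ≠ 0 := by
    rw [leadingCoeff_ne_zero]; rintro rfl; simp at hF
  rw [Monic, leadingCoeff_mul, leadingCoeff_C, leadingCoeff_map_C_sub_C hF, ← C_mul,
    inv_mul_cancel₀ hlc, C_1]

theorem exists_map_aeval_eq_of_dvd {K L : Type*} [Field K] [Field L] [Algebra K L] {x : L}
    (hx : Transcendental K x) {F : K[X]} (hF : F.natDegree ≠ 0) {Q : L[X]} (hQ : Q.Monic)
    (hdvd : Q ∣ F.map (algebraMap K L) - C (aeval x F))
    (hcoeff : ∀ i, Q.coeff i ∈ IntermediateField.adjoin K {x}) :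
    ∃ P : K[X][X], P.Monic ∧ P.map (aeval x).toRingHom = Q ∧ P ∣ F.map C - C F := by
  let e : RatFunc K →+* L := (algebraMap (IntermediateField.adjoin K {x}) L).comp
    (RatFunc.algEquivOfTranscendental x hx : RatFunc K →+* _)
  have he : e.comp (algebraMap K[X] (RatFunc K)) = (aeval x).toRingHom := by
    ext a
    · simp [e, RatFunc.algEquivOfTranscendental_apply]
    · simp [e]
  have hinj : Function.Injective (aeval x : K[X] →ₐ[K] L).toRingHom :=
    transcendental_iff_injective.1 hx
  have hmon := monic_C_inv_mul_map_C_sub_C hF F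
  have hmap : (F.map C - C F).map (aeval x).toRingHom =
      F.map (algebraMap K L) - C (aeval x F) := by
    simp only [Polynomial.map_sub, map_map, map_C]
    congr 2
    ext; simp
  obtain ⟨Q₀, rfl⟩ : ∃ Q₀ : (RatFunc K)[X], Q₀.map e = Q := by
    rw [← mem_lifts, lifts_iff_coeff_lifts]
    intro i
    refine ⟨(RatFunc.algEquivOfTranscendental x hx).symm ⟨_, hcoeff i⟩, ?_⟩
    simp [e]
  have hQ₀ : Q₀.Monic := monic_of_injective e.injective hQ
  have hd₀ : Q₀ ∣ (C (C F.leadingCoeff⁻¹) * (F.map C - C F)).map (algebraMap K[X] (RatFunc K)) := by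
    rw [← map_dvd_map' e, map_map, he, Polynomial.map_mul, hmap]
    exact hdvd.mul_left _
  obtain ⟨P, hP⟩ := IsIntegrallyClosed.eq_map_mul_C_of_dvd (RatFunc K) hmon hd₀
  rw [hQ₀.leadingCoeff, C_1, mul_one] at hP
  have hPm : P.Monic := by
    rw [← hP] at hQ₀
    exact monic_of_injective (FaithfulSMul.algebraMap_injective _ _) hQ₀
  have hPQ : P.map (aeval x).toRingHom = Q₀.map e := by rw [← hP, map_map, he]
  refine ⟨P, hPm, hPQ, ?_⟩
  rwa [← map_dvd_map _ hinj hPm, hmap, hPQ]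

end Polynomial

theorem minpoly.coeff_mem_adjoin_simple {k L : Type*} [Field k] [Field L] [Algebra k L]
    [IsAlgClosed L] [Algebra.IsAlgebraic k L] (E : IntermediateField k L) [IsGalois k E]
    (x : L) (i : ℕ) : ((minpoly E x).coeff i : L) ∈ IntermediateField.adjoin k {x} := by
  set B := IntermediateField.adjoin k {x}
  set c : L := ((minpoly E x).coeff i : L) with hc
  have hxB : x ∈ B := IntermediateField.mem_adjoin_simple_self k x
  have : Algebra.IsAlgebraic B L := Algebra.IsAlgebraic.tower_top (K := k) B
  have hcsep : IsSeparable B c := by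
    have : IsSeparable k c := by
      have := Algebra.IsSeparable.isSeparable k ((minpoly E x).coeff i)
      rwa [IsSeparable, ← minpoly.algebraMap_eq (algebraMap E L).injective] at this
    exact this.tower_top B
  by_contra hcB
  have hcB' : c ∉ (⊥ : Subalgebra B L) := by
    rintro ⟨b, hb⟩
    exact hcB (hb ▸ b.2)
  obtain ⟨y, hcy, hconj⟩ := (notMem_iff_exists_ne_and_isConjRoot hcsep
    (IsAlgClosed.splits _)).1 hcB'
  have : Normal B L := ⟨fun _ ↦ IsAlgClosed.splits _⟩
  obtain ⟨σ, hσ⟩ := isConjRoot_iff_exists_algEquiv.1 hconj.symm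
  let τ : E ≃ₐ[k] E := (σ.restrictScalars k).restrictNormal E
  have hτ (a : E) : ((τ a : E) : L) = σ a :=
    AlgEquiv.restrictNormal_commutes (σ.restrictScalars k) E a
  have hσx : σ x = x := σ.commutes ⟨x, hxB⟩
  have hint : IsIntegral E x := Algebra.IsIntegral.isIntegral x
  have hroot : Polynomial.aeval x ((minpoly E x).map (τ : E →+* E)) = 0 := by
    have h := congr((σ : L →+* L) $(minpoly.aeval E x))
    rw [map_zero, aeval_def, hom_eval₂] at h
    rw [aeval_def, eval₂_map, ← h]
    simp only [RingHom.coe_coe, hσx]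
    congr 1
    ext a
    exact hτ a
  have heq : (minpoly E x).map (τ : E →+* E) = minpoly E x := by
    refine (eq_of_monic_of_dvd_of_natDegree_le (minpoly.monic hint)
      ((minpoly.monic hint).map _) (minpoly.dvd _ _ hroot) ?_)
    rw [natDegree_map]
  apply hcy
  have := congr(((($heq).coeff i : E) : L))
  rw [coeff_map] at this
  rw [← hσ, hc, ← hτ]
  exact this.symm


theorem IntermediateField.eq_zero_of_sum_mul_pow_eq_zero {k L : Type*} [Field k] [Field L]
    [Algebra k L] {E : IntermediateField k L} {x : L} {e : ℕ → L} (he : ∀ j, e j ∈ E)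
    (h : ∑ j ∈ Finset.range (minpoly E x).natDegree, e j * x ^ j = 0) {j : ℕ}
    (hj : j < (minpoly E x).natDegree) : e j = 0 := by
  have hli := Fintype.linearIndependent_iff.1 (linearIndependent_pow (K := E) x)
    (fun i ↦ ⟨e i, he i⟩) (by rwa [Finset.sum_range] at h) ⟨j, hj⟩
  exact congr(($hli : L))

theorem IntermediateField.aeval_mem_of_algebraMap_mem {k L R : Type*} [Field k] [Field L]
    [Algebra k L] [CommRing R] [Algebra R L] {E : IntermediateField k L}
    (hR : ∀ r, algebraMap R L r ∈ E) {x : L} (hx : x ∈ E) (p : R[X]) : aeval x p ∈ E := by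
  rw [aeval_eq_sum_range]
  refine sum_mem fun i _ ↦ ?_
  rw [Algebra.smul_def]
  exact mul_mem (hR _) (pow_mem hx i)

theorem Polynomial.exists_monic_natDegree_eq_aeval_mem {K k L : Type*} [Field K] [Field k] [Field L]
    [Algebra K k] [Algebra K L] [Algebra k L] [IsScalarTower K k L] [IsAlgClosed L]
    [Algebra.IsAlgebraic k L] (E : IntermediateField k L) [IsGalois k E] {x : L}
    (hx : Transcendental K x) (hk : ∀ a : k, algebraMap k L a ∈ IntermediateField.adjoin K {x})
    {F : K[X]} (hF : F.natDegree ≠ 0) (hxF : aeval x F ∈ E) :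
    ∃ p : K[X], p.Monic ∧ p.natDegree = (minpoly E x).natDegree ∧ aeval x p ∈ E := by
  have hint : IsIntegral E x := Algebra.IsIntegral.isIntegral x
  have : IsScalarTower K E L := IsScalarTower.of_algebraMap_eq fun _ ↦ rfl
  have hdvd : (minpoly E x).map (algebraMap E L) ∣ F.map (algebraMap K L) - C (aeval x F) := by
    have h : minpoly E x ∣ F.map (algebraMap K E) - C ⟨aeval x F, hxF⟩ := by
      refine minpoly.dvd _ _ ?_
      rw [map_sub, aeval_map_algebraMap, aeval_C]
      exact sub_self _
    convert Polynomial.map_dvd (algebraMap E L) h using 1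
    rw [Polynomial.map_sub, map_map, map_C]
    rfl
  have hcoeff (i : ℕ) : ((minpoly E x).map (algebraMap E L)).coeff i ∈
      IntermediateField.adjoin K {x} := by
    rw [coeff_map]
    refine (?_ : (IntermediateField.adjoin k {x}).toSubfield ≤
      (IntermediateField.adjoin K {x}).toSubfield) (minpoly.coeff_mem_adjoin_simple E x i)
    rw [IntermediateField.adjoin_toSubfield, Subfield.closure_le]
    rintro _ (⟨a, rfl⟩ | rfl)
    · exact hk a
    · exact IntermediateField.mem_adjoin_simple_self K _
  obtain ⟨P, hP, hPQ, hPd⟩ := exists_map_aeval_eq_of_dvd hx hF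
    ((minpoly.monic hint).map _) hdvd hcoeff
  have hdeg : P.natDegree = (minpoly E x).natDegree := by
    rw [← hP.natDegree_map (aeval x : K[X] →ₐ[K] L).toRingHom, hPQ, natDegree_map]
  have hdeg₀ := natDegree_coeff_zero_of_dvd_map_C_sub_C hF hP hPd
  have hne : (P.coeff 0).leadingCoeff ≠ 0 := by
    rw [leadingCoeff_ne_zero]
    intro h
    rw [h, natDegree_zero, hdeg] at hdeg₀
    exact (minpoly.natDegree_pos hint).ne hdeg₀
  refine ⟨C (P.coeff 0).leadingCoeff⁻¹ * P.coeff 0, ?_, ?_, ?_⟩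
  · rw [Monic, leadingCoeff_mul, leadingCoeff_C, inv_mul_cancel₀ hne]
  · rw [natDegree_C_mul (inv_ne_zero hne), hdeg₀, hdeg]
  · rw [map_mul, aeval_C, IsScalarTower.algebraMap_apply K k L]
    refine mul_mem (E.algebraMap_mem _) ?_
    have h := congr(($hPQ).coeff 0)
    rw [coeff_map, coeff_map] at h
    exact (show aeval x (P.coeff 0) = _ from h) ▸ ((minpoly E x).coeff 0).2

namespace Polynomial

theorem exists_eval₂_aeval_eq_zero_of_irreducible {K L : Type*} [Field K] [Field L] [Algebra K L]
    [IsAlgClosed L] {F G : K[X]} (hG : G.natDegree ≠ 0) {H : K[X][X]} (hH : Irreducible H)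
    (hdvd : H ∣ F.map C - C G) (z : L) : ∃ y : L, eval₂ (aeval y).toRingHom z H = 0 := by
  set H' := Bivariate.swap H with hH'
  have hirr : Irreducible H' := (MulEquiv.irreducible_iff Bivariate.swap).2 hH
  have hdvd' : H' ∣ G.map C - C F := by
    have h : H' ∣ Bivariate.swap (F.map C - C G) := _root_.map_dvd Bivariate.swap hdvd
    rwa [map_sub, Bivariate.swap_map_C, Bivariate.swap_C, ← dvd_neg, neg_sub] at h
  have hlc : IsUnit H'.leadingCoeff := by
    obtain ⟨Q, hQ⟩ := hdvd'
    have h := leadingCoeff_map_C_sub_C hG F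
    rw [hQ, leadingCoeff_mul] at h
    refine isUnit_of_dvd_unit (Dvd.intro _ h) (isUnit_C.2 (IsUnit.mk0 _ ?_))
    rw [leadingCoeff_ne_zero]; rintro rfl; simp at hG
  have hdeg : H'.natDegree ≠ 0 := by
    intro h
    rw [eq_C_of_natDegree_eq_zero h] at hirr hlc
    rw [leadingCoeff_C] at hlc
    exact hirr.not_isUnit (isUnit_C.2 hlc)
  have hdeg' : (H'.map (aeval z : K[X] →ₐ[K] L).toRingHom).natDegree ≠ 0 := by
    rwa [natDegree_map_of_leadingCoeff_ne_zero]
    exact (hlc.map (aeval z : K[X] →ₐ[K] L).toRingHom).ne_zero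
  obtain ⟨y, hy⟩ := IsAlgClosed.exists_root (H'.map (aeval z : K[X] →ₐ[K] L).toRingHom)
    (fun h ↦ hdeg' (natDegree_eq_of_degree_eq_some h))
  refine ⟨y, ?_⟩
  have hswap : (eval₂RingHom (aeval z : K[X] →ₐ[K] L).toRingHom y).comp
      (Bivariate.swap : K[X][X] ≃ₐ[K] K[X][X]).toAlgHom.toRingHom =
      eval₂RingHom (aeval y : K[X] →ₐ[K] L).toRingHom z := by
    ext <;> simp [Bivariate.swap_C, Bivariate.swap_Y]
  rw [IsRoot, eval_map] at hy
  rw [← coe_eval₂RingHom, ← hswap, ← hy]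
  rfl

theorem exists_comp_of_notMem {K k L : Type*} [Field K] [Field k] [Field L]
    [Algebra K k] [Algebra K L] [Algebra k L] [IsScalarTower K k L] [IsAlgClosed L]
    [Algebra.IsAlgebraic k L] (E : IntermediateField k L) [IsGalois k E] {F G : K[X]} {x : L}
    (ht : Transcendental K (aeval x F))
    (hk : ∀ a : k, algebraMap k L a ∈ IntermediateField.adjoin K {x})
    (hF : F.natDegree ≠ 0) (hG : G.natDegree ≠ 0) (hxF : aeval x F ∈ E)
    (hE : ∀ y : L, aeval y G = aeval x F → y ∈ E) (hxE : x ∉ E) :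
    ∃ F₁ F₂ : K[X], F = F₁.comp F₂ ∧ 2 ≤ F₂.natDegree ∧
      ∀ H : K[X][X], Irreducible H → H ∣ F₁.map C - C G → Irreducible (H.comp (F₂.map C)) := by
  have hint : IsIntegral E x := Algebra.IsIntegral.isIntegral x
  have hx : Transcendental K x := (transcendental_aeval_iff.1 ht).1
  obtain ⟨p, hp, hpd, hpE⟩ := exists_monic_natDegree_eq_aeval_mem E hx hk hF hxF
  set z := aeval x p with hz
  have hd : 2 ≤ (minpoly E x).natDegree := by
    by_contra h
    have h1 : (minpoly E x).natDegree = 1 := by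
      have := minpoly.natDegree_pos hint
      omega
    obtain ⟨a, ha⟩ := minpoly.natDegree_eq_one_iff.1 h1
    exact hxE (ha ▸ a.2)
  have hpd0 : p.natDegree ≠ 0 := by omega
  have hzt : Transcendental K z := hx.aeval p hpd0 (by simp [hp.leadingCoeff])
  have hKE (a : K) : algebraMap K L a ∈ E := by
    rw [IsScalarTower.algebraMap_apply K k L]
    exact E.algebraMap_mem _
  obtain ⟨F₁, hF₁⟩ : ∃ F₁ : K[X], F = F₁.comp p := by
    obtain ⟨c, hc⟩ := exists_eq_sum_comp_mul_X_pow hp (Nat.pos_of_ne_zero hpd0) F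
    refine ⟨c 0, ?_⟩
    have hsum := congr(aeval x $hc)
    simp only [map_sum, map_mul, map_pow, aeval_X, aeval_comp, ← hz, hpd] at hsum
    have hzero (j : ℕ) (hj : j < (minpoly E x).natDegree) (hj0 : j ≠ 0) : c j = 0 := by
      have h := IntermediateField.eq_zero_of_sum_mul_pow_eq_zero (E := E) (x := x)
        (e := fun j ↦ aeval z (c j) - if j = 0 then aeval x F else 0) (fun j ↦ ?_) ?_ hj
      · rw [if_neg hj0, sub_zero] at h
        exact (transcendental_iff.1 hzt) _ h
      · refine sub_mem (IntermediateField.aeval_mem_of_algebraMap_mem hKE hpE _) ?_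
        split_ifs
        exacts [hxF, zero_mem _]
      · simp only [sub_mul, Finset.sum_sub_distrib, ← hsum]
        rw [Finset.sum_eq_single_of_mem 0 (Finset.mem_range.2 (by omega))]
        · simp
        · intro b _ hb
          simp [hb]
    conv_lhs => rw [hc]
    rw [hpd, Finset.sum_eq_single_of_mem 0 (Finset.mem_range.2 (by omega))]
    · simp
    · intro b hb hb0
      rw [hzero b (Finset.mem_range.1 hb) hb0]
      simp
  refine ⟨F₁, p, hF₁, by omega, fun H hH hdvd ↦ ?_⟩
  have hF₁d : F₁.natDegree ≠ 0 := by
    rw [hF₁, natDegree_comp] at hF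
    exact left_ne_zero_of_mul hF
  obtain ⟨y, hy⟩ := exists_eval₂_aeval_eq_zero_of_irreducible hG hH hdvd z
  have hF₁z : aeval z F₁ = aeval x F := by rw [hF₁, aeval_comp]
  have hyG : aeval y G = aeval x F := by
    obtain ⟨Q, hQ⟩ := hdvd
    have h := congr(eval₂ (aeval y).toRingHom z $hQ)
    rw [eval₂_mul, hy, zero_mul, eval₂_sub, eval₂_C, eval₂_map, sub_eq_zero] at h
    rw [show (aeval y : K[X] →ₐ[K] L).toRingHom.comp C = algebraMap K L by ext; simp] at h
    rw [← hF₁z]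
    exact h.symm
  have hyE : y ∈ E := hE y hyG
  have hyt : Transcendental K y := by
    rw [← hyG] at ht
    exact (transcendental_aeval_iff.1 ht).1
  let : Algebra K[X] L := (aeval y : K[X] →ₐ[K] L).toRingHom.toAlgebra
  have hfaith : FaithfulSMul K[X] L :=
    (faithfulSMul_iff_algebraMap_injective _ _).2 (transcendental_iff_injective.1 hyt)
  have htower : IsScalarTower K K[X] L := IsScalarTower.of_algebraMap_eq fun a ↦
    ((aeval y : K[X] →ₐ[K] L).commutes a).symm
  have hroot {f : K[X]} (hf : f.natDegree ≠ 0) {w : L} (hw : aeval w f = aeval y G) :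
      IsIntegral K[X] w := by
    refine ⟨_, monic_C_inv_mul_map_C_sub_C hf G, ?_⟩
    rw [← aeval_def, map_mul, map_sub, aeval_C, aeval_C]
    rw [show (f.map C : K[X][X]) = f.map (algebraMap K K[X]) from rfl, aeval_map_algebraMap, hw]
    exact mul_eq_zero_of_right _ (sub_self _)
  have hxi : IsIntegral K[X] x := hroot hF hyG.symm
  have hzi : IsIntegral K[X] z := hroot hF₁d (hF₁z.trans hyG.symm)
  have hXE (r : K[X]) : algebraMap K[X] L r ∈ E :=
    IntermediateField.aeval_mem_of_algebraMap_mem hKE hyE r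
  have hpz : aeval x (p.map C : K[X][X]) = z := by
    rw [show (p.map C : K[X][X]) = p.map (algebraMap K K[X]) from rfl, aeval_map_algebraMap]
  have hHz : Associated (minpoly K[X] z) H :=
    (minpoly.irreducible hzi).associated_of_dvd hH (minpoly.isIntegrallyClosed_dvd hzi hy)
  have hassoc : Associated (minpoly K[X] x) (H.comp (p.map C)) := by
    refine associated_of_dvd_dvd (minpoly.isIntegrallyClosed_dvd hxi ?_) ?_
    · rw [aeval_comp, hpz]
      exact hy
    · have hpCd : (p.map C : K[X][X]).natDegree = p.natDegree := hp.natDegree_map _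
      obtain ⟨c, hc⟩ := exists_eq_sum_comp_mul_X_pow (hp.map (C : K →+* K[X]))
        (by omega) (minpoly K[X] x)
      have hsum := congr(aeval x $hc)
      simp only [map_sum, map_mul, map_pow, aeval_X, aeval_comp, hpz, minpoly.aeval, hpCd,
        hpd] at hsum
      rw [hc]
      refine Finset.dvd_sum fun j hj ↦ Dvd.dvd.mul_right ?_ _
      rw [hpCd, hpd, Finset.mem_range] at hj
      have h := IntermediateField.eq_zero_of_sum_mul_pow_eq_zero
        (fun j ↦ IntermediateField.aeval_mem_of_algebraMap_mem hXE hpE (c j)) hsum.symm hj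
      have hdvd := hHz.symm.dvd.trans (minpoly.isIntegrallyClosed_dvd hzi h)
      exact _root_.map_dvd (compRingHom (p.map C)) hdvd
  exact hassoc.irreducible (minpoly.irreducible hxi)

end Polynomial

/-- `substXY` as a ring homomorphism. -/
noncomputable def substXYRingHom {K : Type*} [CommSemiring K] (F₂ G₂ : K[X]) :
    K[X][X] →+* K[X][X] :=
  eval₂RingHom ((C : K[X] →+* K[X][X]).comp (aeval G₂).toRingHom) (F₂.map C)

theorem substXYRingHom_apply {K : Type*} [CommSemiring K] (F₂ G₂ : K[X]) (H : K[X][X]) :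
    substXYRingHom F₂ G₂ H = substXY F₂ G₂ H := rfl

theorem substXYRingHom_map_C {K : Type*} [CommSemiring K] (F₂ G₂ F : K[X]) :
    substXYRingHom F₂ G₂ (F.map C) = (F.comp F₂).map C := by
  rw [substXYRingHom, coe_eval₂RingHom, eval₂_map, map_comp, comp, eval₂_map]
  congr 1
  ext
  simp

theorem substXYRingHom_C {K : Type*} [CommSemiring K] (F₂ G₂ G : K[X]) :
    substXYRingHom F₂ G₂ (C G) = C (G.comp G₂) := by
  rw [substXYRingHom, coe_eval₂RingHom, eval₂_C, comp_eq_aeval]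
  rfl

theorem substXYRingHom_X {K : Type*} [CommSemiring K] (F₂ G₂ : K[X]) :
    substXYRingHom F₂ G₂ X = F₂.map C := by
  simp [substXYRingHom]

theorem substXY_comp {K : Type*} [CommSemiring K] (F₂ F₃ G₂ G₃ : K[X]) (H : K[X][X]) :
    substXY (F₂.comp F₃) (G₂.comp G₃) H = substXY F₃ G₃ (substXY F₂ G₂ H) := by
  have : substXYRingHom (F₂.comp F₃) (G₂.comp G₃) =
      (substXYRingHom F₃ G₃).comp (substXYRingHom F₂ G₂) := by
    ext : 2
    · ext
      simp [substXYRingHom_C]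
    · simp [substXYRingHom_C]
    · simp [substXYRingHom_X, substXYRingHom_map_C]
  exact congr($this H)

theorem substXY_X_right {K : Type*} [CommSemiring K] (F₂ : K[X]) (H : K[X][X]) :
    substXY F₂ X H = H.comp (F₂.map C) := by
  rw [substXY, comp]
  congr 1
  ext <;> simp

theorem substXY_X_X {K : Type*} [CommSemiring K] (H : K[X][X]) : substXY X X H = H := by
  rw [substXY_X_right, Polynomial.map_X, comp_X]

theorem substXY_X_left {K : Type*} [CommSemiring K] (G₂ : K[X]) (H : K[X][X]) :
    substXY X G₂ H = Bivariate.swap ((Bivariate.swap H).comp (G₂.map C)) := by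
  have : substXYRingHom X G₂ = (Bivariate.swap : K[X][X] ≃ₐ[K] K[X][X]).toAlgHom.toRingHom.comp
      ((compRingHom (G₂.map C)).comp
        (Bivariate.swap : K[X][X] ≃ₐ[K] K[X][X]).toAlgHom.toRingHom) := by
    ext : 2
    · ext
      simp [substXYRingHom_C, Bivariate.swap_C]
    · simp [substXYRingHom_C, Bivariate.swap_C, Bivariate.swap_map_C]
    · simp [substXYRingHom_X, Bivariate.swap_C, Bivariate.swap_Y]
  exact congr($this H)

theorem substXY_map_C_sub_C {K : Type*} [CommRing K] (F₁ F₂ G₁ G₂ : K[X]) :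
    substXY F₂ G₂ (F₁.map C - C G₁) = (F₁.comp F₂).map C - C (G₁.comp G₂) := by
  rw [← substXYRingHom_apply, map_sub, substXYRingHom_map_C, substXYRingHom_C]

section SplittingField

variable {K : Type*} [Field K]

/-- The splitting field of `F(X) - t` over `K(t)`, inside the algebraic closure of `K(t)`. -/
noncomputable abbrev splittingFieldSubX (F : K[X]) :
    IntermediateField (RatFunc K) (AlgebraicClosure (RatFunc K)) :=
  IntermediateField.adjoin (RatFunc K)
    ((F.map (algebraMap K (RatFunc K)) - C RatFunc.X).rootSet (AlgebraicClosure (RatFunc K)))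

theorem transcendental_algebraMap_ratFuncX :
    Transcendental K (algebraMap (RatFunc K) (AlgebraicClosure (RatFunc K)) RatFunc.X) :=
  (transcendental_algebraMap_iff (algebraMap (RatFunc K) _).injective).2 RatFunc.transcendental_X

theorem aeval_map_sub_C_ratFuncX (F : K[X]) (x : AlgebraicClosure (RatFunc K)) :
    aeval x (F.map (algebraMap K (RatFunc K)) - C RatFunc.X) =
      aeval x F - algebraMap (RatFunc K) _ RatFunc.X := by
  rw [map_sub, aeval_map_algebraMap, aeval_C]

theorem map_sub_C_ratFuncX_ne_zero (F : K[X]) :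
    F.map (algebraMap K (RatFunc K)) - C RatFunc.X ≠ 0 := by
  intro h
  have h0 := congr(($h).coeff 0)
  rw [coeff_sub, coeff_map, coeff_C_zero, coeff_zero, sub_eq_zero] at h0
  exact RatFunc.transcendental_X (K := K) (h0 ▸ isAlgebraic_algebraMap _)

theorem mem_rootSet_map_sub_C_ratFuncX {F : K[X]} {x : AlgebraicClosure (RatFunc K)} :
    x ∈ (F.map (algebraMap K (RatFunc K)) - C RatFunc.X).rootSet (AlgebraicClosure (RatFunc K)) ↔
      aeval x F = algebraMap (RatFunc K) _ RatFunc.X := by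
  rw [mem_rootSet, aeval_map_sub_C_ratFuncX, sub_eq_zero]
  exact and_iff_right (map_sub_C_ratFuncX_ne_zero F)

theorem isGalois_splittingFieldSubX {F : K[X]} (hF : derivative F ≠ 0) :
    IsGalois (RatFunc K) (splittingFieldSubX F) := by
  have := IntermediateField.adjoin_rootSet_isSplittingField (K := RatFunc K)
    (L := AlgebraicClosure (RatFunc K)) (p := F.map (algebraMap K (RatFunc K)) - C RatFunc.X)
    (IsAlgClosed.splits _)
  refine IsGalois.of_separable_splitting_field
    (p := F.map (algebraMap K (RatFunc K)) - C RatFunc.X) ?_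
  rw [separable_def, isCoprime_iff_aeval_ne_zero_of_isAlgClosed _ (AlgebraicClosure (RatFunc K))]
  intro x
  by_contra! h
  obtain ⟨h0, h1⟩ := h
  rw [aeval_map_sub_C_ratFuncX, sub_eq_zero] at h0
  rw [derivative_sub, derivative_C, sub_zero, derivative_map, aeval_map_algebraMap] at h1
  have ht := transcendental_algebraMap_ratFuncX (K := K)
  rw [← h0] at ht
  exact (transcendental_aeval_iff.1 ht).1 ⟨_, hF, h1⟩

theorem algebraMap_ratFunc_mem_adjoin {F : K[X]} {x : AlgebraicClosure (RatFunc K)}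
    (hx : aeval x F = algebraMap (RatFunc K) _ RatFunc.X) (a : RatFunc K) :
    algebraMap (RatFunc K) (AlgebraicClosure (RatFunc K)) a ∈ IntermediateField.adjoin K {x} := by
  have hmem (p : K[X]) : algebraMap (RatFunc K) (AlgebraicClosure (RatFunc K))
      (algebraMap K[X] (RatFunc K) p) ∈ IntermediateField.adjoin K {x} := by
    have h : algebraMap K[X] (RatFunc K) p = aeval RatFunc.X p := by
      rw [← RatFunc.algebraMap_X, aeval_algebraMap_apply, aeval_X_left_apply]
    rw [h, ← aeval_algebraMap_apply, ← hx]
    exact IntermediateField.aeval_mem_of_algebraMap_mem (IntermediateField.algebraMap_mem _)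
      (IntermediateField.aeval_mem_of_algebraMap_mem (IntermediateField.algebraMap_mem _)
        (IntermediateField.mem_adjoin_simple_self K x) F) p
  rw [← RatFunc.num_div_denom a, map_div₀]
  exact div_mem (hmem _) (hmem _)

theorem exists_comp_of_not_splittingFieldSubX_le {F G : K[X]} (hF : F.natDegree ≠ 0)
    (hG : derivative G ≠ 0) (hle : ¬ splittingFieldSubX F ≤ splittingFieldSubX G) :
    ∃ F₁ F₂ : K[X], F = F₁.comp F₂ ∧ 2 ≤ F₂.natDegree ∧
      ∀ H : K[X][X], Irreducible H → H ∣ F₁.map C - C G → Irreducible (substXY F₂ X H) := by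
  rw [IntermediateField.adjoin_le_iff, Set.not_subset] at hle
  obtain ⟨x, hx, hxG⟩ := hle
  rw [mem_rootSet_map_sub_C_ratFuncX] at hx
  have := isGalois_splittingFieldSubX hG
  simp only [substXY_X_right]
  refine exists_comp_of_notMem (splittingFieldSubX G)
    (hx ▸ transcendental_algebraMap_ratFuncX) (algebraMap_ratFunc_mem_adjoin hx) hF ?_
    (hx ▸ IntermediateField.algebraMap_mem _ _) (fun y hy ↦ ?_) hxG
  · exact fun h ↦ hG (derivative_of_natDegree_zero h)
  · exact IntermediateField.subset_adjoin _ _ (mem_rootSet_map_sub_C_ratFuncX.2 (hy.trans hx))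

theorem derivative_ne_zero_of_comp {F₁ F₂ : K[X]} (h : derivative (F₁.comp F₂) ≠ 0) :
    derivative F₁ ≠ 0 := by
  rintro h0
  rw [derivative_comp, h0, zero_comp, mul_zero] at h
  exact h rfl

theorem natDegree_lt_natDegree_comp {F₁ F₂ : K[X]} (h : (F₁.comp F₂).natDegree ≠ 0)
    (h2 : 2 ≤ F₂.natDegree) : F₁.natDegree < (F₁.comp F₂).natDegree := by
  rw [natDegree_comp] at h ⊢
  have := Nat.pos_of_ne_zero (left_ne_zero_of_mul h)
  nlinarith

theorem exists_comp_splittingFieldSubX_eq (F G : K[X]) (hF : derivative F ≠ 0)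
    (hG : derivative G ≠ 0) :
    ∃ F₁ F₂ G₁ G₂ : K[X], F = F₁.comp F₂ ∧ G = G₁.comp G₂ ∧
      (∀ H : K[X][X], Irreducible H → H ∣ F₁.map C - C G₁ → Irreducible (substXY F₂ G₂ H)) ∧
      splittingFieldSubX F₁ = splittingFieldSubX G₁ := by
  have hFd : F.natDegree ≠ 0 := fun h ↦ hF (derivative_of_natDegree_zero h)
  have hGd : G.natDegree ≠ 0 := fun h ↦ hG (derivative_of_natDegree_zero h)
  induction hn : F.natDegree + G.natDegree using Nat.strong_induction_on generalizing F G with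
  | _ n ih =>
  by_cases hFG : splittingFieldSubX F ≤ splittingFieldSubX G
  · by_cases hGF : splittingFieldSubX G ≤ splittingFieldSubX F
    · exact ⟨F, X, G, X, comp_X.symm, comp_X.symm, fun H hH _ ↦ by rwa [substXY_X_X],
        le_antisymm hFG hGF⟩
    · obtain ⟨G₀, G₃, rfl, hdeg, hirr⟩ := exists_comp_of_not_splittingFieldSubX_le hGd hF hGF
      have hG₀ := derivative_ne_zero_of_comp hG
      obtain ⟨F₁, F₂, G₁, G₂, rfl, rfl, hirr', heq⟩ := ih _
        (by have := natDegree_lt_natDegree_comp hGd hdeg; omega) F G₀ hF hG₀ hFd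
        (fun h ↦ hG₀ (derivative_of_natDegree_zero h)) rfl
      refine ⟨F₁, F₂, G₁, G₂.comp G₃, rfl, comp_assoc _ _ _, fun H hH hdvd ↦ ?_, heq⟩
      rw [← comp_X (p := F₂), substXY_comp, substXY_X_left, ← substXY_X_right]
      refine (MulEquiv.irreducible_iff Bivariate.swap).2 (hirr _
        ((MulEquiv.irreducible_iff Bivariate.swap).2 (hirr' H hH hdvd)) ?_)
      have h := _root_.map_dvd Bivariate.swap (_root_.map_dvd (substXYRingHom F₂ G₂) hdvd)
      rwa [substXYRingHom_apply, substXYRingHom_apply, substXY_map_C_sub_C, map_sub,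
        Bivariate.swap_map_C, Bivariate.swap_C, ← dvd_neg, neg_sub] at h
  · obtain ⟨F₀, F₃, rfl, hdeg, hirr⟩ := exists_comp_of_not_splittingFieldSubX_le hFd hG hFG
    have hF₀ := derivative_ne_zero_of_comp hF
    obtain ⟨F₁, F₂, G₁, G₂, rfl, rfl, hirr', heq⟩ := ih _
      (by have := natDegree_lt_natDegree_comp hFd hdeg; omega) F₀ G hF₀ hG
      (fun h ↦ hF₀ (derivative_of_natDegree_zero h)) hGd rfl
    refine ⟨F₁, F₂.comp F₃, G₁, G₂, comp_assoc _ _ _, rfl, fun H hH hdvd ↦ ?_, heq⟩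
    rw [← comp_X (p := G₂), substXY_comp]
    refine hirr _ (hirr' H hH hdvd) ?_
    have h := _root_.map_dvd (substXYRingHom F₂ G₂) hdvd
    rwa [substXYRingHom_apply, substXYRingHom_apply, substXY_map_C_sub_C] at h

end SplittingField

/-- Fried's lemma: if `F, G ∈ K[X]` have nonzero derivatives, then there are decompositions
`F = F₁ ∘ F₂`, `G = G₁ ∘ G₂` such that the irreducible factors of `F(X) - G(Y)` are precisely
(up to associates) the polynomials `H(F₂(X), G₂(Y))` with `H` an irreducible factor of
`F₁(X) - G₁(Y)`, and the splitting fields of `F₁(X) - t` and `G₁(X) - t` over `K(t)`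
(taken inside a fixed algebraic closure of `K(t) = RatFunc K`) coincide. -/
theorem statement3 {K : Type*} [Field K] (F G : K[X])
    (hF : derivative F ≠ 0) (hG : derivative G ≠ 0) :
    ∃ F₁ F₂ G₁ G₂ : K[X],
      F = F₁.comp F₂ ∧ G = G₁.comp G₂ ∧
      (∀ q : Polynomial (Polynomial K),
        (Irreducible q ∧ q ∣ (F.map (C : K →+* K[X]) - C G)) ↔
          ∃ H : Polynomial (Polynomial K), Irreducible H ∧
            H ∣ (F₁.map (C : K →+* K[X]) - C G₁) ∧ Associated q (substXY F₂ G₂ H)) ∧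
      IntermediateField.adjoin (RatFunc K)
          ((F₁.map (algebraMap K (RatFunc K)) - C RatFunc.X).rootSet
            (AlgebraicClosure (RatFunc K))) =
        IntermediateField.adjoin (RatFunc K)
          ((G₁.map (algebraMap K (RatFunc K)) - C RatFunc.X).rootSet
            (AlgebraicClosure (RatFunc K))) := by
  obtain ⟨F₁, F₂, G₁, G₂, rfl, rfl, hirr, heq⟩ := exists_comp_splittingFieldSubX_eq F G hF hG
  refine ⟨F₁, F₂, G₁, G₂, rfl, rfl, fun q ↦ ⟨fun ⟨hq, hdvd⟩ ↦ ?_, ?_⟩, heq⟩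
  · have hF₁ : F₁.natDegree ≠ 0 := fun h ↦
      derivative_ne_zero_of_comp hF (derivative_of_natDegree_zero h)
    have hne : F₁.map (C : K →+* K[X]) - C G₁ ≠ 0 := by
      intro h
      have hlc := leadingCoeff_map_C_sub_C hF₁ G₁
      rw [h, leadingCoeff_zero, eq_comm, C_eq_zero, leadingCoeff_eq_zero] at hlc
      simp [hlc] at hF₁
    obtain ⟨s, hs, hprod⟩ := WfDvdMonoid.exists_factors _ hne
    rw [← substXY_map_C_sub_C, ← substXYRingHom_apply,
      ← (hprod.map (substXYRingHom F₂ G₂)).dvd_iff_dvd_right, map_multiset_prod] at hdvd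
    obtain ⟨H, hHs, hqH⟩ := hq.prime.exists_mem_multiset_map_dvd hdvd
    have hHd := (Multiset.dvd_prod hHs).trans hprod.dvd
    exact ⟨H, hs H hHs, hHd, hq.associated_of_dvd (hirr H (hs H hHs) hHd) hqH⟩
  · rintro ⟨H, hH, hdvd, hassoc⟩
    refine ⟨hassoc.symm.irreducible (hirr H hH hdvd), hassoc.dvd.trans ?_⟩
    rw [← substXY_map_C_sub_C, ← substXYRingHom_apply, ← substXYRingHom_apply]
    exact _root_.map_dvd _ hdvd
end

section
/- Let K be a field, and let F, G, F̂, Ĝ ∈ K[X] be nonconstant polynomials such that F ∘ G = F̂ ∘ Ĝ, deg(F) = deg(F̂), and the characteristic of K does not divide deg(F). Then Ĝ = L ∘ G for some polynomial L ∈ K[X] of degree one. -/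
open Polynomial

/-- The top coefficient of the homogeneous sum `∑ u ^ i * h ^ (n - 1 - i)` when `u` and `h` have
the same coefficient in degree `m`. -/
lemma coeff_geom_sum₂_of_natDegree_le {R : Type*} [CommRing R] {u h : R[X]} {m : ℕ}
    (hu : u.natDegree ≤ m) (hh : h.natDegree ≤ m) (huh : u.coeff m = h.coeff m) (n : ℕ) :
    (∑ i ∈ Finset.range n, u ^ i * h ^ (n - 1 - i)).coeff ((n - 1) * m) =
      n * h.coeff m ^ (n - 1) := by
  rw [finsetSum_coeff, Finset.sum_congr rfl (g := fun _ ↦ h.coeff m ^ (n - 1))]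
  · simp
  intro i hi
  have hin : i + (n - 1 - i) = n - 1 := by
    have := Finset.mem_range.1 hi
    omega
  have hdeg : (n - 1) * m = i * m + (n - 1 - i) * m := by rw [← add_mul, hin]
  rw [hdeg, coeff_mul_add_eq_of_natDegree_le (natDegree_pow_le_of_le i hu)
    (natDegree_pow_le_of_le _ hh), coeff_pow_of_natDegree_le hu, coeff_pow_of_natDegree_le hh,
    huh, ← pow_add, hin]

lemma comp_eq_eraseLead_comp_add {R : Type*} [CommRing R] (F G : R[X]) :
    F.comp G = F.eraseLead.comp G + C F.leadingCoeff * G ^ F.natDegree := by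
  conv_lhs => rw [← F.eraseLead_add_C_mul_X_pow, add_comp, C_mul_comp, X_pow_comp]

lemma natDegree_eraseLead_comp_le {R : Type*} [CommRing R] (F G : R[X]) :
    (F.eraseLead.comp G).natDegree ≤ (F.natDegree - 1) * G.natDegree :=
  natDegree_comp_le.trans (Nat.mul_le_mul_right _ F.eraseLead_natDegree_le)

/-- Uniqueness in polynomial decomposition: if `F ∘ G = F̂ ∘ Ĝ` with all four polynomials
nonconstant, `deg F = deg F̂`, and `char K ∤ deg F`, then `Ĝ = L ∘ G` for some degree-one
polynomial `L ∈ K[X]`. -/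
theorem statement4 {K : Type*} [Field K] (F G Fhat Ghat : K[X])
    (hF : 0 < F.natDegree) (hG : 0 < G.natDegree)
    (hFhat : 0 < Fhat.natDegree) (hGhat : 0 < Ghat.natDegree)
    (hcomp : F.comp G = Fhat.comp Ghat)
    (hdeg : F.natDegree = Fhat.natDegree)
    (hchar : ¬ (ringChar K ∣ F.natDegree)) :
    ∃ L : K[X], L.natDegree = 1 ∧ Ghat = L.comp G := by
  have hm : G.natDegree = Ghat.natDegree := by
    have h := congrArg natDegree hcomp
    rw [natDegree_comp, natDegree_comp, ← hdeg] at h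
    exact Nat.eq_of_mul_eq_mul_left hF h
  have hlc : F.leadingCoeff * G.leadingCoeff ^ F.natDegree =
      Fhat.leadingCoeff * Ghat.leadingCoeff ^ F.natDegree := by
    have h := congrArg leadingCoeff hcomp
    rwa [leadingCoeff_comp hG.ne', leadingCoeff_comp hGhat.ne', ← hdeg] at h
  have hn : (F.natDegree : K) ≠ 0 := fun h ↦ hchar ((ringChar.spec K _).1 h)
  have hG0 : G.leadingCoeff ≠ 0 := leadingCoeff_ne_zero.2 (ne_zero_of_natDegree_gt hG)
  have hGhat0 : Ghat.leadingCoeff ≠ 0 := leadingCoeff_ne_zero.2 (ne_zero_of_natDegree_gt hGhat)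
  have hFhat0 : Fhat.leadingCoeff ≠ 0 := leadingCoeff_ne_zero.2 (ne_zero_of_natDegree_gt hFhat)
  set n := F.natDegree with hn_def
  set c := Ghat.leadingCoeff / G.leadingCoeff with hc_def
  have hc : c ≠ 0 := div_ne_zero hGhat0 hG0
  have hFc : F.leadingCoeff = Fhat.leadingCoeff * c ^ n := by
    rw [hc_def, div_pow, mul_div_assoc', ← hlc, mul_div_cancel_right₀ _ (pow_ne_zero _ hG0)]
  have hu : (C c * G).natDegree ≤ Ghat.natDegree := hm ▸ natDegree_C_mul_le c G
  have huh : (C c * G).coeff Ghat.natDegree = Ghat.coeff Ghat.natDegree := by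
    rw [coeff_C_mul, ← hm, coeff_natDegree, hc_def, div_mul_cancel₀ _ hG0, hm, coeff_natDegree]
  set S := ∑ i ∈ Finset.range n, (C c * G) ^ i * Ghat ^ (n - 1 - i)
  have hS : S.coeff ((n - 1) * Ghat.natDegree) ≠ 0 := by
    rw [coeff_geom_sum₂_of_natDegree_le hu le_rfl huh]
    exact mul_ne_zero hn (pow_ne_zero _ hGhat0)
  have key : C Fhat.leadingCoeff * (S * (C c * G - Ghat)) =
      Fhat.eraseLead.comp Ghat - F.eraseLead.comp G := by
    rw [geom_sum₂_mul]
    rw [comp_eq_eraseLead_comp_add F, comp_eq_eraseLead_comp_add Fhat, ← hdeg, hFc, C_mul,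
      C_pow] at hcomp
    linear_combination hcomp
  have hle : (S * (C c * G - Ghat)).natDegree ≤ (n - 1) * Ghat.natDegree := by
    rw [← natDegree_C_mul hFhat0, key]
    refine (natDegree_sub_le _ _).trans (max_le ?_ ?_)
    · rw [hdeg]
      exact natDegree_eraseLead_comp_le Fhat Ghat
    · rw [← hm]
      exact natDegree_eraseLead_comp_le F G
  have hconst : (C c * G - Ghat).natDegree = 0 := by
    by_cases h0 : C c * G - Ghat = 0
    · rw [h0, natDegree_zero]
    have hS0 : S ≠ 0 := fun h ↦ hS (by rw [h, coeff_zero])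
    rw [natDegree_mul hS0 h0] at hle
    have := le_natDegree_of_ne_zero hS
    omega
  refine ⟨C c * X + C (-((C c * G - Ghat).coeff 0)), natDegree_linear hc, ?_⟩
  have h := eq_C_of_natDegree_eq_zero hconst
  rw [add_comp, C_mul_comp, X_comp, C_comp, C_neg]
  linear_combination -h
end

section
/- Let K be an algebraically closed field of odd characteristic, and let f ∈ K[X] be an additive polynomial with f'(0) ≠ 0. Then there exists a unique polynomial f̂ ∈ K[X] such that f(X) + X·f'(0) = X·f̂(X²); moreover f̂ is squarefree, deg(f̂) = (deg(f) − 1)/2, and f̂(0) ≠ 0. -/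
open Polynomial

theorem IsAdditive.comp_add {K : Type*} [CommSemiring K] {f : K[X]} (hf : IsAdditive f)
    (a b : K[X]) : f.comp (a + b) = f.comp a + f.comp b := by
  have h := congrArg (eval₂RingHom (aeval a : K[X] →ₐ[K] K[X]).toRingHom b) hf
  simp only [aeval_def, map_add, hom_eval₂] at h
  have hc : ((eval₂RingHom (aeval a : K[X] →ₐ[K] K[X]).toRingHom b).comp
      (algebraMap K K[X][X])) = C := by
    ext x
    simp
  rw [hc] at h
  simpa [comp] using h

theorem IsAdditive.coeff_zero_s5 {K : Type*} [CommRing K] {f : K[X]} (hf : IsAdditive f) :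
    f.coeff 0 = 0 := by
  have h := congrArg (coeff · 0) (hf.comp_add 0 0)
  simpa [← coeff_zero_eq_eval_zero] using h

theorem IsAdditive.comp_neg_X_s5 {K : Type*} [CommRing K] {f : K[X]} (hf : IsAdditive f) :
    f.comp (-X) = -f := by
  have h := hf.comp_add (-X) X
  rw [neg_add_cancel, comp_zero, ← coeff_zero_eq_eval_zero, hf.coeff_zero_s5, C_0, comp_X] at h
  exact eq_neg_of_add_eq_zero_left h.symm

theorem IsAdditive.coeff_of_even {K : Type*} [Field K] (h2 : (2 : K) ≠ 0) {f : K[X]}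
    (hf : IsAdditive f) {n : ℕ} (hn : Even n) : f.coeff n = 0 := by
  have h := congrArg (coeff · n) hf.comp_neg_X_s5
  rw [show (-X : K[X]) = C (-1) * X by simp] at h
  simp only [comp_C_mul_X_coeff, hn.neg_one_pow, mul_one, coeff_neg] at h
  have h' : 2 * f.coeff n = 0 := by linear_combination h
  exact (mul_eq_zero.mp h').resolve_left h2

theorem IsAdditive.derivative_eq_C_s5 {K : Type*} [CommRing K] {f : K[X]} (hf : IsAdditive f) :
    derivative f = C (eval 0 (derivative f)) := by
  have key (q : K[X][X]) : aeval q f = (f.map C).comp q := by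
    rw [comp, eval₂_map]
    rfl
  have h := congrArg (fun g => eval 0 (derivative g)) hf
  simpa [key, derivative_comp, derivative_map, eval_comp, eval_map,
    ← coeff_zero_eq_eval_zero] using h

/-- For an additive polynomial `f` over an algebraically closed field of odd characteristic
with `f'(0) ≠ 0`, there is a unique `f̂ ∈ K[X]` with `f(X) + X·f'(0) = X·f̂(X²)`; moreover
`f̂` is squarefree, `deg f̂ = (deg f - 1)/2`, and `f̂(0) ≠ 0`. -/
theorem statement5 {K : Type*} [Field K] [IsAlgClosed K] (p : ℕ) [CharP K p] (hp : Odd p)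
    (f : K[X]) (hf : IsAdditive f) (hf0 : eval 0 (derivative f) ≠ 0) :
    ∃ fhat : K[X],
      (f + C (eval 0 (derivative f)) * X = X * fhat.comp (X ^ 2)) ∧
      Squarefree fhat ∧
      fhat.natDegree = (f.natDegree - 1) / 2 ∧
      eval 0 fhat ≠ 0 ∧
      ∀ h : K[X], (f + C (eval 0 (derivative f)) * X = X * h.comp (X ^ 2)) → h = fhat := by
  have h2 : (2 : K) ≠ 0 := by
    apply Ring.two_ne_zero
    rw [ringChar.eq K p]
    rintro rfl
    exact absurd hp (by decide)
  have hder := hf.derivative_eq_C_s5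
  have hc1 : f.coeff 1 = eval 0 (derivative f) := by
    rw [← coeff_zero_eq_eval_zero, coeff_derivative]
    simp
  set c := eval 0 (derivative f) with hc
  set g := f + C c * X with hg
  have hgX : X * g.divX = g := by
    have h := X_mul_divX_add g
    rwa [show g.coeff 0 = 0 by simp [hg, hf.coeff_zero_s5], C_0, add_zero] at h
  have hexp : (contract 2 g.divX).comp (X ^ 2) = g.divX := by
    rw [← expand_eq_comp_X_pow]
    ext n
    rw [coeff_expand two_pos]
    split_ifs with hn
    · rw [coeff_contract two_ne_zero, Nat.div_mul_cancel hn]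
    · have hev : Even (n + 1) := by
        rw [Nat.even_add_one, even_iff_two_dvd]
        exact hn
      rw [coeff_divX, hg, coeff_add, hf.coeff_of_even h2 hev, coeff_C_mul_X,
        if_neg, add_zero]
      intro h
      rw [h] at hev
      exact absurd hev (by decide)
  have hgsep : g.Separable := by
    refine ⟨0, C (2 * c)⁻¹, ?_⟩
    rw [hg, derivative_add, hder, derivative_C_mul, derivative_X, mul_one, zero_mul, zero_add,
      ← C_add, ← C_mul, ← two_mul, inv_mul_cancel₀ (mul_ne_zero h2 hf0), C_1]
  have hfd : 1 ≤ f.natDegree := le_natDegree_of_ne_zero (hc1 ▸ hf0)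
  have hg1 : g.coeff 1 = 2 * c := by
    simp [hg, hc1, two_mul]
  have hgd : g.natDegree = f.natDegree := by
    rcases hfd.eq_or_lt with h | h
    · refine le_antisymm ?_ (h ▸ le_natDegree_of_ne_zero (hg1 ▸ mul_ne_zero h2 hf0))
      exact natDegree_add_le_of_degree_le le_rfl (((natDegree_C_mul_le c X).trans natDegree_X_le).trans hfd)
    · exact natDegree_add_eq_left_of_natDegree_lt (((natDegree_C_mul_le c X).trans natDegree_X_le).trans_lt h)
  refine ⟨contract 2 g.divX, ?_, ?_, ?_, ?_, ?_⟩
  · rw [hexp, hgX]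
  · rintro d ⟨e, he⟩
    have hu : IsUnit (d.comp (X ^ 2)) := by
      apply hgsep.squarefree
      refine ⟨X * e.comp (X ^ 2), ?_⟩
      rw [← hgX, ← hexp, he, mul_comp, mul_comp]
      ring
    rw [← expand_eq_comp_X_pow] at hu
    exact (isLocalHom_expand K two_pos).map_nonunit d hu
  · have h := congrArg natDegree hexp
    rw [natDegree_comp, natDegree_X_pow, natDegree_divX_eq_natDegree_tsub_one, hgd] at h
    omega
  · rw [← coeff_zero_eq_eval_zero, coeff_contract two_ne_zero, zero_mul, coeff_divX, zero_add, hg1]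
    exact mul_ne_zero h2 hf0
  · intro h hh
    apply expand_injective (R := K) two_pos
    rw [expand_eq_comp_X_pow, expand_eq_comp_X_pow, hexp]
    exact mul_left_cancel₀ X_ne_zero (hh.symm.trans hgX.symm)
end

section
/- Let K be a field, let t be transcendental over K, and let F₁, G₁ ∈ K[X] be nonconstant polynomials whose degrees are not divisible by the characteristic of K. If the splitting field of F₁(X) − t over K(t) equals the splitting field of G₁(X) − t over K(t), then deg(F₁) = deg(G₁). -/
open Polynomial

open LaurentSeries

/-- The `X`-adic valuation on Laurent series is trivial on constants. -/
theorem LaurentSeries.valuation_C_eq_one {k : Type*} [Field k] {a : k} (ha : a ≠ 0) :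
    (Valued.v : Valuation k⸨X⸩ (WithZero (Multiplicative ℤ))) (HahnSeries.C a) = 1 := by
  have hle : ∀ b : k,
      (Valued.v : Valuation k⸨X⸩ (WithZero (Multiplicative ℤ))) (HahnSeries.C b) ≤ 1 := fun b ↦
    (LaurentSeries.val_le_one_iff_eq_coe k _).2 ⟨PowerSeries.C b, PowerSeries.coe_C b⟩
  refine le_antisymm (hle a) ?_
  have h := hle a⁻¹
  rw [map_inv₀, map_inv₀] at h
  have h0 : (Valued.v : Valuation k⸨X⸩ (WithZero (Multiplicative ℤ))) (HahnSeries.C a) ≠ 0 := by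
    simpa using ha
  exact (inv_le_one₀ (zero_lt_iff.2 h0)).1 h

/-- The structure map to Laurent series factors through the constants. -/
theorem LaurentSeries.algebraMap_eq_C_comp (K k : Type*) [Field K] [Field k] [Algebra K k] :
    algebraMap K k⸨X⸩ = HahnSeries.C.comp (algebraMap K k) := by
  ext1 a
  rw [HahnSeries.algebraMap_apply', RingHom.comp_apply, PowerSeries.algebraMap_apply, HahnSeries.ofPowerSeries_C]

theorem LaurentSeries.isTrivialOn_valuation (K : Type*) {k : Type*} [Field K] [Field k]
    [Algebra K k] :
    (Valued.v : Valuation k⸨X⸩ (WithZero (Multiplicative ℤ))).IsTrivialOn K where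
  eq_one a ha := by
    rw [LaurentSeries.algebraMap_eq_C_comp]
    exact LaurentSeries.valuation_C_eq_one (by simpa using ha)

/-- If a polynomial of degree `m` takes a value with a pole of order `n` at a Laurent series,
then `m ∣ n`. -/
theorem LaurentSeries.natDegree_dvd_of_aeval_eq_single {K k : Type*} [Field K] [Field k]
    [Algebra K k] {G : K[X]} {n : ℕ} (hn : 0 < n) {y : k⸨X⸩}
    (hy : aeval y G = HahnSeries.single (-(n : ℤ)) (1 : k)) : G.natDegree ∣ n := by
  have := LaurentSeries.isTrivialOn_valuation K (k := k)
  have hG : G ≠ 0 := by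
    rintro rfl
    rw [map_zero, eq_comm, HahnSeries.single_eq_zero_iff] at hy
    exact one_ne_zero hy
  have hv := congrArg (Valued.v : Valuation k⸨X⸩ (WithZero (Multiplicative ℤ))) hy
  rw [LaurentSeries.valuation_single_zpow, neg_neg] at hv
  have hlt : 1 < (Valued.v : Valuation k⸨X⸩ (WithZero (Multiplicative ℤ))) y := by
    by_contra! hle
    have h1 : (Valued.v : Valuation k⸨X⸩ (WithZero (Multiplicative ℤ))) (aeval y G) ≤ 1 := by
      rw [aeval_eq_sum_range]
      refine Valuation.map_sum_le _ fun i _ ↦ ?_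
      rw [Algebra.smul_def, map_mul, map_pow]
      refine mul_le_one' ?_ (pow_le_one' hle _)
      by_cases hc : G.coeff i = 0
      · simp [hc]
      · exact (this.eq_one _ hc).le
    rw [hv, ← WithZero.exp_zero, WithZero.exp_le_exp] at h1
    omega
  rw [valuation_aeval_eq_valuation_X_pow_natDegree_of_one_lt_valuation_X y hlt hG] at hv
  have hlog := congrArg WithZero.log hv
  rw [WithZero.log_pow, WithZero.log_exp, nsmul_eq_mul] at hlog
  exact Int.natCast_dvd_natCast.1 ⟨_, hlog.symm⟩

/-- If `P` is monic and its degree `n` is invertible, every `u₀` with `u₀ ^ n = c ≠ 0` is the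
coefficient of `X⁻¹` in a Laurent series solution of `P(y) = c X⁻ⁿ`. -/
theorem LaurentSeries.exists_root_of_pow_eq {k : Type*} [Field k] {P : k[X]} (hP : P.Monic)
    (hPc : (P.natDegree : k) ≠ 0) {c u₀ : k} (hc : c ≠ 0) (hu : u₀ ^ P.natDegree = c) :
    ∃ y : k⸨X⸩, eval₂ HahnSeries.C y P = HahnSeries.single (-(P.natDegree : ℤ)) c ∧
      y.coeff (-1) = u₀ := by
  have hn : P.natDegree ≠ 0 := fun h ↦ hPc (by simp [h])
  set Q : (PowerSeries k)[X] :=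
    (P.map PowerSeries.C).scaleRoots PowerSeries.X - C (PowerSeries.C c) with hQ
  have hPm : (P.map (PowerSeries.C (R := k))).natDegree = P.natDegree := hP.natDegree_map _
  have hQm : Q.Monic := by
    refine ((monic_scaleRoots_iff _).2 (hP.map _)).sub_of_left ?_
    rw [degree_scaleRoots, degree_eq_natDegree (hP.map _).ne_zero, hPm]
    exact degree_C_le.trans_lt (by exact_mod_cast Nat.pos_of_ne_zero hn)
  have hQ0 : Q.map PowerSeries.constantCoeff = X ^ P.natDegree - C c := by
    rw [hQ, Polynomial.map_sub, map_scaleRoots _ _ _ (by simp [(hP.map _).leadingCoeff])]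
    simp [Polynomial.map_map, hP.leadingCoeff]
  have heval : ∀ (R : (PowerSeries k)[X]) (f : PowerSeries k),
      PowerSeries.constantCoeff (R.eval f) =
        (R.map PowerSeries.constantCoeff).eval (PowerSeries.constantCoeff f) := fun R f ↦ by
    rw [eval_map, eval₂_at_apply]
  obtain ⟨u, hu1, hu2⟩ := HenselianRing.is_henselian
    (I := Ideal.span {(PowerSeries.X : PowerSeries k)}) Q hQm (PowerSeries.C u₀)
    (by
      rw [Ideal.mem_span_singleton, PowerSeries.X_dvd_iff, heval, hQ0]
      simp [hu])
    (by
      refine IsUnit.map _ (PowerSeries.isUnit_iff_constantCoeff.2 ?_)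
      have hu0 : u₀ ≠ 0 := by
        rintro rfl
        exact hc (by rw [← hu, zero_pow hn])
      rw [heval, ← derivative_map, hQ0]
      simp [derivative_X_pow, hu0, hPc])
  rw [Ideal.mem_span_singleton, PowerSeries.X_dvd_iff, map_sub, sub_eq_zero] at hu2
  have hX : (HahnSeries.single (-1 : ℤ) (1 : k)) * HahnSeries.single 1 1 = 1 := by
    simp
  refine ⟨HahnSeries.single (-1) 1 * HahnSeries.ofPowerSeries ℤ k u, ?_, ?_⟩
  · have h1 := congrArg (HahnSeries.ofPowerSeries ℤ k) hu1
    set y : k⸨X⸩ := HahnSeries.single (-1) 1 * HahnSeries.ofPowerSeries ℤ k u with hy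
    have hyu : HahnSeries.ofPowerSeries ℤ k u =
        HahnSeries.ofPowerSeries ℤ k PowerSeries.X * y := by
      rw [hy, ← mul_assoc, HahnSeries.ofPowerSeries_X, mul_comm (HahnSeries.single 1 1), hX,
        one_mul]
    have hC : (HahnSeries.ofPowerSeries ℤ k).comp PowerSeries.C = HahnSeries.C :=
      RingHom.ext fun a ↦ PowerSeries.coe_C a
    rw [hQ, ← eval₂_at_apply, hyu, eval₂_sub, scaleRoots_eval₂_mul, eval₂_C, eval₂_map, hC,
      map_zero, sub_eq_zero, hPm, HahnSeries.ofPowerSeries_X, HahnSeries.ofPowerSeries_C] at h1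
    have h2 := congrArg (HahnSeries.single (-1 : ℤ) (1 : k) ^ P.natDegree * ·) h1
    simp only [← mul_assoc, ← mul_pow, hX, one_pow, one_mul] at h2
    rw [h2, HahnSeries.single_pow]
    simp [HahnSeries.C_apply]
  · have := HahnSeries.coeff_single_mul_add (r := (1 : k)) (x := HahnSeries.ofPowerSeries ℤ k u)
      (a := 0) (b := -1)
    rw [zero_add, one_mul] at this
    rw [this]
    have h0 := LaurentSeries.coeff_coe_powerSeries u 0
    simpa [hu2] using h0

/-- Puiseux expansion at infinity: over an algebraically closed field in which `deg P` is
invertible, `P(Y) - X ^ (-deg P)` splits over the field of Laurent series. -/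
theorem LaurentSeries.splits_sub_single {k : Type*} [Field k] [IsAlgClosed k] {P : k[X]}
    (hPc : (P.natDegree : k) ≠ 0) :
    (P.map HahnSeries.C -
      C (HahnSeries.single (-(P.natDegree : ℤ)) (1 : k) : k⸨X⸩)).Splits := by
  classical
  have hn : P.natDegree ≠ 0 := fun h ↦ hPc (by simp [h])
  have hP0 : P ≠ 0 := by rintro rfl; simp at hn
  set a := P.leadingCoeff with ha
  have ha0 : a ≠ 0 := leadingCoeff_ne_zero.2 hP0
  set R : k⸨X⸩[X] := P.map HahnSeries.C -
    C (HahnSeries.single (-(P.natDegree : ℤ)) (1 : k) : k⸨X⸩) with hR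
  have hRd : R.natDegree = P.natDegree := by
    rw [hR, natDegree_sub_C, natDegree_map]
  have hR0 : R ≠ 0 := by
    intro h
    rw [h, natDegree_zero] at hRd
    exact hn hRd.symm
  have hPm : (P * C a⁻¹).Monic := monic_mul_leadingCoeff_inv hP0
  have hPd : (P * C a⁻¹).natDegree = P.natDegree :=
    natDegree_mul_leadingCoeff_inv P hP0
  have hroot : ∀ u : k, u ^ P.natDegree = a⁻¹ → ∃ y : k⸨X⸩, R.IsRoot y ∧ y.coeff (-1) = u := by
    intro u hu
    obtain ⟨y, hy, hyu⟩ := LaurentSeries.exists_root_of_pow_eq hPm (by rwa [hPd])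
      (inv_ne_zero ha0) (by rwa [hPd])
    refine ⟨y, ?_, hyu⟩
    have hCa : (HahnSeries.C a⁻¹ : k⸨X⸩) ≠ 0 := by simpa using ha0
    rw [hPd, eval₂_mul, eval₂_C] at hy
    rw [IsRoot, hR, eval_sub, eval_C, eval_map, sub_eq_zero]
    refine mul_right_cancel₀ hCa (hy.trans ?_)
    simp [HahnSeries.C_apply]
  choose! r hr hru using hroot
  have hsep : (X ^ P.natDegree - C a⁻¹ : k[X]).Separable :=
    separable_X_pow_sub_C _ hPc (inv_ne_zero ha0)
  have hcard : (X ^ P.natDegree - C a⁻¹ : k[X]).roots.toFinset.card = P.natDegree := by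
    rw [Multiset.toFinset_card_of_nodup (nodup_roots hsep),
      splits_iff_card_roots.1 (IsAlgClosed.splits _), natDegree_X_pow_sub_C]
  have hpow : ∀ u ∈ (X ^ P.natDegree - C a⁻¹ : k[X]).roots.toFinset, u ^ P.natDegree = a⁻¹ := by
    intro u hu
    simpa [sub_eq_zero] using (mem_roots'.1 (Multiset.mem_toFinset.1 hu)).2
  refine splits_iff_card_roots.2 (le_antisymm (card_roots' R) ?_)
  rw [hRd, ← hcard]
  refine le_trans ?_ (Multiset.toFinset_card_le _)
  refine Finset.card_le_card_of_injOn r (fun u hu ↦ ?_) fun u hu v hv huv ↦ ?_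
  · rw [Finset.mem_coe, Multiset.mem_toFinset, mem_roots hR0]
    exact hr u (hpow u hu)
  · rw [← hru u (hpow u hu), huv, hru v (hpow v hv)]

/-- If the splitting field of `F - t` over `K(t)` contains that of `G - t`, and `deg F` is
invertible in `K`, then `deg G ∣ deg F`. -/
theorem natDegree_dvd_of_adjoin_rootSet_le {K : Type*} [Field K] {F G : K[X]}
    (hG : 0 < G.natDegree) (hFc : (F.natDegree : K) ≠ 0)
    (h : IntermediateField.adjoin (RatFunc K)
          ((G.map (algebraMap K (RatFunc K)) - C RatFunc.X).rootSet
            (AlgebraicClosure (RatFunc K))) ≤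
        IntermediateField.adjoin (RatFunc K)
          ((F.map (algebraMap K (RatFunc K)) - C RatFunc.X).rootSet
            (AlgebraicClosure (RatFunc K)))) :
    G.natDegree ∣ F.natDegree := by
  have hn : 0 < F.natDegree := Nat.pos_of_ne_zero fun h ↦ hFc (by simp [h])
  set k := AlgebraicClosure K
  set s : k⸨X⸩ := HahnSeries.single (-(F.natDegree : ℤ)) (1 : k) with hs
  have htriv := LaurentSeries.isTrivialOn_valuation K (k := k)
  have htr : Transcendental K s := by
    refine Valuation.transcendental_of_ne_one K (v := Valued.v (R := k⸨X⸩)) s ?_ ?_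
    · simp [hs]
    · rw [hs, LaurentSeries.valuation_single_zpow, ← WithZero.exp_zero, Ne, WithZero.exp_inj]
      omega
  let ψ : RatFunc K →+* k⸨X⸩ := RatFunc.liftRingHom (aeval (R := K) s).toRingHom
    (nonZeroDivisors_le_comap_nonZeroDivisors_of_injective _
      (transcendental_iff_injective.1 htr))
  have hψX : ψ RatFunc.X = s := by
    rw [← RatFunc.algebraMap_X]
    simp [ψ]
  have hψC : ψ.comp (algebraMap K (RatFunc K)) = algebraMap K k⸨X⸩ := by
    ext1 a
    rw [RingHom.comp_apply, IsScalarTower.algebraMap_apply K K[X] (RatFunc K)]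
    simp [ψ]
  let : Algebra (RatFunc K) k⸨X⸩ := ψ.toAlgebra
  set p := F.map (algebraMap K (RatFunc K)) - C RatFunc.X with hp
  set q := G.map (algebraMap K (RatFunc K)) - C RatFunc.X with hq
  have hp0 : p ≠ 0 := by
    intro h0
    have := congrArg natDegree h0
    rw [hp, natDegree_sub_C, natDegree_map, natDegree_zero] at this
    omega
  have hqd : q.natDegree = G.natDegree := by rw [hq, natDegree_sub_C, natDegree_map]
  have hmap : ∀ H : K[X], (H.map (algebraMap K (RatFunc K)) - C RatFunc.X).map
      (algebraMap (RatFunc K) k⸨X⸩) = H.map (algebraMap K k⸨X⸩) - C s := by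
    intro H
    change Polynomial.map ψ _ = _
    rw [Polynomial.map_sub, Polynomial.map_map, hψC, map_C, hψX]
  have hsplit : (p.map (algebraMap (RatFunc K) k⸨X⸩)).Splits := by
    rw [hp, hmap, LaurentSeries.algebraMap_eq_C_comp K k, ← Polynomial.map_map]
    have h1 := LaurentSeries.splits_sub_single (P := F.map (algebraMap K k))
      (by rw [natDegree_map, ← map_natCast (algebraMap K k)]; exact (_root_.map_ne_zero _).2 hFc)
    rw [natDegree_map] at h1
    exact h1
  obtain ⟨φ⟩ := IntermediateField.nonempty_algHom_adjoin_of_splits (F := RatFunc K)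
    (S := p.rootSet (AlgebraicClosure (RatFunc K))) (K := k⸨X⸩) fun x hx ↦ by
      have hx' : aeval x p = 0 := aeval_eq_zero_of_mem_rootSet hx
      refine ⟨(isAlgebraic_iff_isIntegral.1 ⟨p, hp0, hx'⟩), ?_⟩
      exact hsplit.of_dvd (Polynomial.map_ne_zero hp0)
        (Polynomial.map_dvd _ (minpoly.dvd _ _ hx'))
  obtain ⟨y, hy⟩ := IsAlgClosed.exists_aeval_eq_zero (AlgebraicClosure (RatFunc K)) q
    (by rintro h0; rw [natDegree_eq_zero_iff_degree_le_zero.2 h0.le] at hqd; omega)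
  have hq0 : q ≠ 0 := by rintro h0; rw [h0, natDegree_zero] at hqd; omega
  have hyF := h (IntermediateField.subset_adjoin _ _ ((mem_rootSet_of_ne hq0).2 hy))
  have hφ : aeval (φ ⟨y, hyF⟩) q = 0 := by
    rw [aeval_algHom_apply, map_eq_zero]
    refine Subtype.val_injective ?_
    rw [IntermediateField.coe_zero, ← hy]
    exact (aeval_algHom_apply (IntermediateField.val _) (⟨y, hyF⟩ : _) q).symm
  refine LaurentSeries.natDegree_dvd_of_aeval_eq_single hn (y := φ ⟨y, hyF⟩) ?_
  rwa [aeval_def, ← eval_map, hq, hmap, eval_sub, eval_C, eval_map, sub_eq_zero] at hφ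

/-- If `F₁, G₁ ∈ K[X]` are nonconstant with degrees not divisible by `char K`, and the
splitting fields of `F₁(X) - t` and `G₁(X) - t` over `K(t)` (taken inside a fixed algebraic
closure of `K(t) = RatFunc K`, with `t = RatFunc.X` transcendental over `K`) coincide,
then `deg F₁ = deg G₁`. -/
theorem statement15 {K : Type*} [Field K] (F₁ G₁ : K[X])
    (hF : 0 < F₁.natDegree) (hG : 0 < G₁.natDegree)
    (hFc : ¬ (ringChar K ∣ F₁.natDegree)) (hGc : ¬ (ringChar K ∣ G₁.natDegree))
    (h : IntermediateField.adjoin (RatFunc K)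
          ((F₁.map (algebraMap K (RatFunc K)) - C RatFunc.X).rootSet
            (AlgebraicClosure (RatFunc K))) =
        IntermediateField.adjoin (RatFunc K)
          ((G₁.map (algebraMap K (RatFunc K)) - C RatFunc.X).rootSet
            (AlgebraicClosure (RatFunc K)))) :
    F₁.natDegree = G₁.natDegree := by
  exact Nat.dvd_antisymm
    (natDegree_dvd_of_adjoin_rootSet_le hF (fun h0 ↦ hGc (ringChar.dvd h0)) h.le)
    (natDegree_dvd_of_adjoin_rootSet_le hG (fun h0 ↦ hFc (ringChar.dvd h0)) h.ge)
end
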